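/- Set u = (G_n G_{n−1})^{p−1}. For every e ≥ 0, multiplication by u^{p^e} maps Ω^{[p^e]} into Ω^{[p^{e+1}]} and I^{[p^e]} into I^{[p^{e+1}]}, and the local cohomology module H^2_{I_{n−1}(X)}(k[[X]]) is isomorphic to the colimit of the direct system Ω/I → Ω^{[p]}/I^{[p]} → Ω^{[p^2]}/I^{[p^2]} → ⋯ whose e-th transition map Ω^{[p^e]}/I^{[p^e]} → Ω^{[p^{e+1}]}/I^{[p^{e+1}]} is induced by multiplication by u^{p^e}. -/

import Mathlib

/-- `𝔞^{[q]}`: the ideal generated by the `q`-th powers of all elements of `𝔞`. -/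
def frobPow {R : Type} [CommRing R] (q : ℕ) (a : Ideal R) : Ideal R :=
  Ideal.span ((fun x => x ^ q) '' (a : Set R))

/-- For the generic `n × (n-1)` matrix `X` (with `n = m + 2`) over `R = k[[X]]`,
`Gmin k m i` is the maximal minor obtained by deleting the `i`-th row. -/
noncomputable def Gmin (k : Type) [Field k] (m : ℕ) (i : Fin (m + 2)) :
    MvPowerSeries (Fin (m + 2) × Fin (m + 1)) k :=
  (Matrix.of fun r c : Fin (m + 1) =>
    (MvPowerSeries.X (i.succAbove r, c) : MvPowerSeries (Fin (m + 2) × Fin (m + 1)) k)).det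

/-- `gmin k m j` is the `(n-2) × (n-2)` minor of the submatrix `X'` formed by the first
`n - 2` rows of `X`, obtained by deleting the `j`-th column. -/
noncomputable def gmin (k : Type) [Field k] (m : ℕ) (j : Fin (m + 1)) :
    MvPowerSeries (Fin (m + 2) × Fin (m + 1)) k :=
  (Matrix.of fun r c : Fin m =>
    (MvPowerSeries.X (Fin.castAdd 2 r, j.succAbove c) :
      MvPowerSeries (Fin (m + 2) × Fin (m + 1)) k)).det

/-- `I = I_{n-1}(X)`, the ideal of maximal minors. -/
noncomputable def Imax (k : Type) [Field k] (m : ℕ) :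
    Ideal (MvPowerSeries (Fin (m + 2) × Fin (m + 1)) k) :=
  Ideal.span (Set.range (Gmin k m))

/-- `P = I_{n-2}(X')` (equal to `R` when `n = 2`). -/
noncomputable def Psub (k : Type) [Field k] (m : ℕ) :
    Ideal (MvPowerSeries (Fin (m + 2) × Fin (m + 1)) k) :=
  Ideal.span (Set.range (gmin k m))

/-- `Ω = I + P`. -/
noncomputable def Omeg (k : Type) [Field k] (m : ℕ) :
    Ideal (MvPowerSeries (Fin (m + 2) × Fin (m + 1)) k) :=
  Imax k m ⊔ Psub k m


/-- `u = (G_n G_{n-1})^{p-1}`. -/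
noncomputable def ugen (k : Type) [Field k] (m p : ℕ) :
    MvPowerSeries (Fin (m + 2) × Fin (m + 1)) k :=
  (Gmin k m (Fin.last (m + 1)) * Gmin k m (Fin.castSucc (Fin.last m))) ^ (p - 1)

/-- The `R`-module `Ω^{[p^e]}/I^{[p^e]}`. -/
abbrev quotFrob (k : Type) [Field k] (m p e : ℕ) : Type :=
  ↥(frobPow (p ^ e) (Omeg k m)) ⧸
    Submodule.comap (frobPow (p ^ e) (Omeg k m)).subtype
      (frobPow (p ^ e) (Imax k m) :
        Submodule (MvPowerSeries (Fin (m + 2) × Fin (m + 1)) k)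
          (MvPowerSeries (Fin (m + 2) × Fin (m + 1)) k))

/-- `c` is a nonzerodivisor modulo the ideal `J`. -/
def IsRegularMod {A : Type*} [CommRing A] (J : Ideal A) (c : A) : Prop :=
  ∀ z, c * z ∈ J → z ∈ J

section HilbertBurch

open Matrix

/-- The square matrix with first row `r` followed by the rows of `B`. -/
def consRow {A : Type*} {ν : ℕ} (r : Fin (ν + 1) → A) (B : Matrix (Fin ν) (Fin (ν + 1)) A) :
    Matrix (Fin (ν + 1)) (Fin (ν + 1)) A :=
  fun i j => Fin.cases (r j) (fun l => B l j) i

@[simp] theorem consRow_zero {A : Type*} {ν : ℕ} (r : Fin (ν + 1) → A)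
    (B : Matrix (Fin ν) (Fin (ν + 1)) A) (j : Fin (ν + 1)) : consRow r B 0 j = r j := rfl

@[simp] theorem consRow_succ {A : Type*} {ν : ℕ} (r : Fin (ν + 1) → A)
    (B : Matrix (Fin ν) (Fin (ν + 1)) A) (i : Fin ν) (j : Fin (ν + 1)) :
    consRow r B i.succ j = B i j := rfl

variable {A : Type*} [CommRing A]

/-- The vector of signed maximal minors of a `ν × (ν+1)` matrix. -/
def signedMinors {ν : ℕ} (B : Matrix (Fin ν) (Fin (ν + 1)) A) : Fin (ν + 1) → A :=
  fun j => (-1) ^ (j : ℕ) * (B.submatrix id j.succAbove).det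

theorem det_cons_row {ν : ℕ} (B : Matrix (Fin ν) (Fin (ν + 1)) A) (r : Fin (ν + 1) → A) :
    (consRow r B).det = r ⬝ᵥ signedMinors B := by
  rw [Matrix.det_succ_row_zero, dotProduct]
  refine Finset.sum_congr rfl fun j _ => ?_
  have : (consRow r B).submatrix Fin.succ j.succAbove
      = B.submatrix id j.succAbove := by
    ext a b; simp
  rw [this, signedMinors, consRow_zero]
  ring

theorem adjugate_cons_row {ν : ℕ} (B : Matrix (Fin ν) (Fin (ν + 1)) A) (r : Fin (ν + 1) → A)
    (j : Fin (ν + 1)) :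
    (consRow r B).adjugate j 0 = signedMinors B j := by
  rw [Matrix.adjugate_fin_succ_eq_det_submatrix]
  have : (consRow r B).submatrix
      (Fin.succAbove 0) j.succAbove = B.submatrix id j.succAbove := by
    ext a b; simp
  rw [this, signedMinors]
  simp

theorem mulVec_signedMinors {ν : ℕ} (B : Matrix (Fin ν) (Fin (ν + 1)) A) :
    B *ᵥ signedMinors B = 0 := by
  ext i
  have h := det_cons_row B (B i)
  rw [Matrix.det_zero_of_row_eq (i := 0) (j := i.succ) (by simp [Fin.ext_iff])
    (by ext; simp)] at h
  simpa [Matrix.mulVec] using h.symm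

theorem smul_signedMinors_of_mulVec_eq_zero {ν : ℕ} (B : Matrix (Fin ν) (Fin (ν + 1)) A)
    {w : Fin (ν + 1) → A} (hw : B *ᵥ w = 0) (i j : Fin (ν + 1)) :
    signedMinors B i * w j = w i * signedMinors B j := by
  set r : Fin (ν + 1) → A := Pi.single i 1
  set M := consRow r B with hM
  have h1 : M *ᵥ w = Pi.single 0 (w i) := by
    ext l
    refine Fin.cases ?_ (fun l => ?_) l
    · simp [hM, Matrix.mulVec, r, dotProduct, Pi.single_apply]
    · have := congrFun hw l
      simpa [hM, Matrix.mulVec] using this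
  have h2 : M.adjugate *ᵥ (M *ᵥ w) = M.det • w := by
    rw [Matrix.mulVec_mulVec, Matrix.adjugate_mul, Matrix.smul_mulVec, Matrix.one_mulVec]
  have h3 := congrFun h2 j
  rw [h1, hM, det_cons_row] at h3
  simp only [mulVec_single, op_smul_eq_smul, Pi.smul_apply, smul_eq_mul,
    Matrix.col_apply, adjugate_cons_row] at h3
  simp only [r, single_dotProduct, one_mul] at h3
  exact h3.symm

theorem exists_eq_smul_signedMinors {ν : ℕ} (B : Matrix (Fin ν) (Fin (ν + 1)) A)
    (i j : Fin (ν + 1)) (hi : IsRegularMod ⊥ (signedMinors B i))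
    (hj : IsRegularMod (Ideal.span {signedMinors B i}) (signedMinors B j))
    {w : Fin (ν + 1) → A} (hw : B *ᵥ w = 0) :
    ∃ c : A, w = c • signedMinors B := by
  have h := smul_signedMinors_of_mulVec_eq_zero B hw
  obtain ⟨c, hc⟩ := Ideal.mem_span_singleton'.1 (hj (w i)
    (Ideal.mem_span_singleton'.2 ⟨w j, by linear_combination h i j⟩))
  refine ⟨c, funext fun l => sub_eq_zero.1 (hi _ ?_)⟩
  simp only [Pi.smul_apply, smul_eq_mul, Ideal.mem_bot]
  linear_combination h i l - signedMinors B l * hc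

theorem eq_zero_of_vecMul_eq_zero {ν : ℕ} (B : Matrix (Fin ν) (Fin (ν + 1)) A)
    (i : Fin (ν + 1)) (hi : IsRegularMod ⊥ (signedMinors B i))
    {s : Fin ν → A} (hs : s ᵥ* B = 0) : s = 0 := by
  have h1 : s ᵥ* (B.submatrix id i.succAbove) = 0 := by
    ext l
    have := congrFun hs (i.succAbove l)
    simpa [Matrix.vecMul, dotProduct] using this
  have h2 : (B.submatrix id i.succAbove).det • s = 0 := by
    rw [← Matrix.vecMul_one s, ← Matrix.vecMul_smul, ← Matrix.mul_adjugate, ← Matrix.vecMul_vecMul,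
      h1, Matrix.zero_vecMul]
  ext l
  refine hi _ ?_
  have := congrFun h2 l
  simp only [Pi.smul_apply, smul_eq_mul, Pi.zero_apply] at this
  simp [signedMinors, mul_assoc, this]

theorem exists_eq_vecMul_of_dotProduct_signedMinors {ν : ℕ} (B : Matrix (Fin ν) (Fin (ν + 1)) A)
    (i j : Fin (ν + 1)) (hi : IsRegularMod ⊥ (signedMinors B i))
    (hj : IsRegularMod (Ideal.span {signedMinors B i}) (signedMinors B j))
    {w : Fin (ν + 1) → A} (hw : w ⬝ᵥ signedMinors B = 0) :
    ∃ s : Fin ν → A, w = s ᵥ* B := by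
  set M := consRow w B with hM
  have hdet : M.det = 0 := by rw [hM, det_cons_row, hw]
  have key : ∀ l, ∃ s : Fin ν → A, signedMinors B l • w = s ᵥ* B := by
    intro l
    refine ⟨fun t => - M.adjugate l t.succ, ?_⟩
    ext c
    have h := congrFun (congrFun (Matrix.adjugate_mul M) l) c
    rw [hdet, zero_smul, Matrix.mul_apply, Fin.sum_univ_succ] at h
    have h0 : M.adjugate l 0 = signedMinors B l := adjugate_cons_row B w l
    rw [h0] at h
    simp only [hM, consRow_zero, consRow_succ, Matrix.zero_apply] at h
    simp only [Pi.smul_apply, smul_eq_mul, vecMul, dotProduct, neg_mul, Finset.sum_neg_distrib]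
    exact eq_neg_of_add_eq_zero_left h
  obtain ⟨s, hs⟩ := key i
  obtain ⟨t, ht⟩ := key j
  have hst : signedMinors B j • s = signedMinors B i • t := by
    rw [← sub_eq_zero]
    apply eq_zero_of_vecMul_eq_zero B i hi
    rw [Matrix.sub_vecMul, Matrix.smul_vecMul, Matrix.smul_vecMul, ← hs, ← ht, smul_comm, sub_self]
  have : ∀ l, ∃ c, s l = signedMinors B i * c := fun l => by
    obtain ⟨c, hc⟩ := Ideal.mem_span_singleton'.1 (hj (s l) (Ideal.mem_span_singleton'.2
      ⟨t l, by have := congrFun hst l; simp at this; linear_combination -this⟩))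
    exact ⟨c, by linear_combination -hc⟩
  choose c hc using this
  refine ⟨c, funext fun l => sub_eq_zero.1 (hi _ ?_)⟩
  have h1 : s = signedMinors B i • c := funext hc
  have h2 := congrFun hs l
  rw [h1, Matrix.smul_vecMul] at h2
  simp only [Pi.smul_apply, smul_eq_mul] at h2
  simp [mul_sub, h2]

end HilbertBurch

section Linkage

open Matrix

variable {A : Type*} [CommRing A] {m : ℕ} (Y : Matrix (Fin (m + 2)) (Fin (m + 1)) A)

theorem isRegularMod_neg_one_pow_mul {J : Ideal A} {c : A} (n : ℕ) (h : IsRegularMod J c) :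
    IsRegularMod J ((-1) ^ n * c) := fun z hz => h z <| by
  have h1 : ((-1 : A) ^ n) * (-1) ^ n = 1 := by rw [← mul_pow]; simp
  have := J.mul_mem_left ((-1) ^ n) hz
  rwa [mul_assoc, ← mul_assoc, h1, one_mul] at this

theorem span_singleton_neg_one_pow_mul (n : ℕ) (c : A) :
    Ideal.span {(-1) ^ n * c} = Ideal.span {c} :=
  Ideal.span_singleton_mul_left_unit ((isUnit_neg_one).pow n) c

/-- The maximal minor of `Y` obtained by deleting row `i`. -/
def maxMinor (i : Fin (m + 2)) : A := (Y.submatrix i.succAbove id).det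

/-- The maximal minor of the first `m` rows of `Y` obtained by deleting column `j`. -/
def subMinor (j : Fin (m + 1)) : A := (Y.submatrix (Fin.castAdd 2) j.succAbove).det

/-- The ideal generated by the last two maximal minors of `Y`. -/
def linkIdeal : Ideal A :=
  Ideal.span {maxMinor Y (Fin.last (m + 1)), maxMinor Y (Fin.castSucc (Fin.last m))}

/-- The signed maximal minors of the first `m` rows of `Y`. -/
def subVec : Fin (m + 1) → A := signedMinors (Y.submatrix (Fin.castAdd 2) id)

theorem subVec_apply (j : Fin (m + 1)) : subVec Y j = (-1) ^ (j : ℕ) * subMinor Y j := rfl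

theorem signedMinors_transpose (i : Fin (m + 2)) :
    signedMinors Yᵀ i = (-1) ^ (i : ℕ) * maxMinor Y i := by
  rw [signedMinors, maxMinor, ← Matrix.det_transpose]
  rfl

theorem maxMinor_last :
    maxMinor Y (Fin.last (m + 1)) =
      (-1) ^ m * (Y (Fin.castSucc (Fin.last m)) ⬝ᵥ subVec Y) := by
  rw [maxMinor, Matrix.det_succ_row _ (Fin.last m), dotProduct, Finset.mul_sum]
  refine Finset.sum_congr rfl fun j _ => ?_
  have : (Y.submatrix (Fin.last (m + 1)).succAbove id).submatrix (Fin.last m).succAbove j.succAbove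
      = Y.submatrix (Fin.castAdd 2) j.succAbove := by
    ext a b; simp; rfl
  rw [this, subVec_apply, subMinor]
  simp [pow_add]
  ring

theorem maxMinor_castSucc_last :
    maxMinor Y (Fin.castSucc (Fin.last m)) =
      (-1) ^ m * (Y (Fin.last (m + 1)) ⬝ᵥ subVec Y) := by
  rw [maxMinor, Matrix.det_succ_row _ (Fin.last m), dotProduct, Finset.mul_sum]
  refine Finset.sum_congr rfl fun j _ => ?_
  have : (Y.submatrix (Fin.castSucc (Fin.last m)).succAbove id).submatrix
      (Fin.last m).succAbove j.succAbove = Y.submatrix (Fin.castAdd 2) j.succAbove := by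
    ext a b
    simp only [submatrix_apply, id_eq, Fin.succAbove_last]
    congr 1
    rw [Fin.succAbove_of_castSucc_lt _ _ (by simp [Fin.lt_def])]
    rfl
  rw [this, subVec_apply, subMinor]
  have : (Fin.castSucc (Fin.last m)).succAbove (Fin.last m) = Fin.last (m + 1) := by
    rw [Fin.succAbove_of_le_castSucc _ _ (by simp)]; rfl
  simp [pow_add, this]
  ring

theorem dotProduct_subVec_mem (i : Fin (m + 2)) : Y i ⬝ᵥ subVec Y ∈ linkIdeal Y := by
  have h1 : ((-1 : A) ^ m) * (-1) ^ m = 1 := by rw [← mul_pow]; simp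
  refine Fin.lastCases ?_ (fun i => Fin.lastCases ?_ (fun i => ?_) i) i
  · refine Ideal.mem_span_pair.2 ⟨0, (-1) ^ m, ?_⟩
    rw [maxMinor_castSucc_last, ← mul_assoc, h1]; ring
  · refine Ideal.mem_span_pair.2 ⟨(-1) ^ m, 0, ?_⟩
    rw [maxMinor_last, ← mul_assoc, h1]; ring
  · have := congrFun (mulVec_signedMinors (Y.submatrix (Fin.castAdd 2) id)) i
    have h2 : Y i.castSucc.castSucc ⬝ᵥ subVec Y = 0 := this
    rw [h2]; exact zero_mem _

theorem exists_vecMul_eq_maxMinor_smul (i : Fin (m + 2)) (w : Fin (m + 1) → A) :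
    ∃ s, s ᵥ* Y = maxMinor Y i • w := by
  refine ⟨fun l => Fin.succAboveCases (α := fun _ => A) i 0
    (w ᵥ* (Y.submatrix i.succAbove id).adjugate) l, ?_⟩
  have h : w ᵥ* (Y.submatrix i.succAbove id).adjugate ᵥ* (Y.submatrix i.succAbove id)
      = maxMinor Y i • w := by
    rw [Matrix.vecMul_vecMul, Matrix.adjugate_mul, Matrix.vecMul_smul, Matrix.vecMul_one, maxMinor]
  rw [← h]
  ext j
  simp [vecMul, dotProduct, Fin.sum_univ_succAbove _ i]

theorem dotProduct_subVec_mem_of_vecMul (s : Fin (m + 2) → A) :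
    (s ᵥ* Y) ⬝ᵥ subVec Y ∈ linkIdeal Y := by
  rw [← Matrix.dotProduct_mulVec]
  exact Ideal.sum_mem _ fun i _ => Ideal.mul_mem_left _ _ (dotProduct_subVec_mem Y i)

theorem maxMinor_mul_subMinor_mem (i : Fin (m + 2)) (j : Fin (m + 1)) :
    maxMinor Y i * subMinor Y j ∈ linkIdeal Y := by
  obtain ⟨s, hs⟩ := exists_vecMul_eq_maxMinor_smul Y i (Pi.single j ((-1) ^ (j : ℕ)))
  have := dotProduct_subVec_mem_of_vecMul Y s
  have h1 : ((-1 : A) ^ (j : ℕ)) * (-1) ^ (j : ℕ) = 1 := by rw [← mul_pow]; simp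
  rwa [hs, smul_dotProduct, single_dotProduct, subVec_apply, ← mul_assoc, h1, one_mul,
    smul_eq_mul] at this

/-- The ideal of maximal minors of `Y`. -/
def maxIdeal : Ideal A := Ideal.span (Set.range (maxMinor Y))

/-- The ideal of maximal minors of the first `m` rows of `Y`. -/
def subIdeal : Ideal A := Ideal.span (Set.range (subMinor Y))

theorem linkIdeal_le_maxIdeal : linkIdeal Y ≤ maxIdeal Y := by
  refine Ideal.span_mono ?_
  rintro _ (rfl | rfl) <;> exact ⟨_, rfl⟩

theorem dotProduct_subVec_mem_subIdeal (w : Fin (m + 1) → A) : w ⬝ᵥ subVec Y ∈ subIdeal Y :=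
  Ideal.sum_mem _ fun j _ => Ideal.mul_mem_left _ _ <| by
    rw [subVec_apply]; exact Ideal.mul_mem_left _ _ (Ideal.subset_span ⟨j, rfl⟩)

theorem exists_dotProduct_subVec {x : A} (hx : x ∈ subIdeal Y) : ∃ w, x = w ⬝ᵥ subVec Y := by
  obtain ⟨c, hc⟩ := Ideal.mem_span_range_iff_exists_fun.1 hx
  refine ⟨fun j => (-1) ^ (j : ℕ) * c j, ?_⟩
  rw [← hc, dotProduct]
  refine Finset.sum_congr rfl fun j _ => ?_
  have h1 : ((-1 : A) ^ (j : ℕ)) * (-1) ^ (j : ℕ) = 1 := by rw [← mul_pow]; simp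
  rw [subVec_apply]
  linear_combination - c j * subMinor Y j * h1

theorem mul_mem_linkIdeal {x y : A} (hx : x ∈ maxIdeal Y) (hy : y ∈ subIdeal Y) :
    x * y ∈ linkIdeal Y := by
  have : maxIdeal Y * subIdeal Y ≤ linkIdeal Y := by
    rw [maxIdeal, subIdeal, Ideal.span_mul_span', Ideal.span_le]
    rintro _ ⟨_, ⟨i, rfl⟩, _, ⟨j, rfl⟩, rfl⟩
    exact maxMinor_mul_subMinor_mem Y i j
  exact this (Ideal.mul_mem_mul hx hy)

/-- The sequences of minors whose regularity drives the linkage of `maxIdeal Y` and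
`subIdeal Y`. -/
structure MinorsRegular : Prop where
  last : IsRegularMod ⊥ (maxMinor Y (Fin.last (m + 1)))
  castSucc_last : IsRegularMod (Ideal.span {maxMinor Y (Fin.last (m + 1))})
    (maxMinor Y (Fin.castSucc (Fin.last m)))
  subMinor_zero : IsRegularMod ⊥ (subMinor Y 0)
  subMinor_last : IsRegularMod (Ideal.span {subMinor Y 0}) (subMinor Y (Fin.last m))
  zero_of_sub : IsRegularMod (Ideal.span {subMinor Y 0, subMinor Y (Fin.last m)}) (maxMinor Y 0)
  zero_of_sub_zero : IsRegularMod (Ideal.span {subMinor Y 0}) (maxMinor Y 0)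
  last_of_sub_zero : IsRegularMod (Ideal.span {subMinor Y 0, maxMinor Y 0})
    (maxMinor Y (Fin.last (m + 1)))

variable {Y}

theorem MinorsRegular.subVec_zero (h : MinorsRegular Y) : IsRegularMod ⊥ (subVec Y 0) :=
  isRegularMod_neg_one_pow_mul _ h.subMinor_zero

theorem MinorsRegular.subVec_last (h : MinorsRegular Y) :
    IsRegularMod (Ideal.span {subVec Y 0}) (subVec Y (Fin.last m)) := by
  rw [subVec_apply, subVec_apply, span_singleton_neg_one_pow_mul]
  exact isRegularMod_neg_one_pow_mul _ h.subMinor_last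

theorem MinorsRegular.transpose_last (h : MinorsRegular Y) :
    IsRegularMod ⊥ (signedMinors Yᵀ (Fin.last (m + 1))) := by
  rw [signedMinors_transpose]
  exact isRegularMod_neg_one_pow_mul _ h.last

theorem MinorsRegular.transpose_castSucc_last (h : MinorsRegular Y) :
    IsRegularMod (Ideal.span {signedMinors Yᵀ (Fin.last (m + 1))})
      (signedMinors Yᵀ (Fin.castSucc (Fin.last m))) := by
  rw [signedMinors_transpose, signedMinors_transpose, span_singleton_neg_one_pow_mul]
  exact isRegularMod_neg_one_pow_mul _ h.castSucc_last

theorem MinorsRegular.exists_mulVec_eq_single (h : MinorsRegular Y) {y : A}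
    (hy : ∀ i, y * maxMinor Y i ∈ linkIdeal Y) (i : Fin m) :
    ∃ z, Y.submatrix (Fin.castAdd 2) id *ᵥ z = Pi.single i y := by
  obtain ⟨α, β, hαβ⟩ := Ideal.mem_span_pair.1 (hy (Fin.castAdd 2 i))
  have h1 : ∀ n : ℕ, ((-1 : A) ^ n) * (-1) ^ n = 1 := fun n => by rw [← mul_pow]; simp
  obtain ⟨s, hs⟩ := exists_eq_vecMul_of_dotProduct_signedMinors Yᵀ _ _ h.transpose_last
    h.transpose_castSucc_last (w := Pi.single (Fin.castAdd 2 i) ((-1) ^ (i : ℕ) * y)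
      - Pi.single (Fin.last (m + 1)) ((-1) ^ (m + 1) * α)
      - Pi.single (Fin.castSucc (Fin.last m)) ((-1) ^ m * β)) (by
        simp only [sub_dotProduct, single_dotProduct, signedMinors_transpose, Fin.val_castAdd,
          Fin.val_last, Fin.val_castSucc]
        linear_combination y * maxMinor Y (Fin.castAdd 2 i) * h1 i
          - α * maxMinor Y (Fin.last (m + 1)) * h1 (m + 1)
          - β * maxMinor Y (Fin.castSucc (Fin.last m)) * h1 m - hαβ)
  refine ⟨((-1 : A) ^ (i : ℕ)) • s, ?_⟩
  rw [Matrix.vecMul_transpose] at hs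
  ext l
  have hl := congrFun hs (Fin.castAdd 2 l)
  have e1 : Fin.castAdd 2 l ≠ Fin.last (m + 1) := by
    have := l.2; simp only [ne_eq, Fin.ext_iff, Fin.val_castAdd, Fin.val_last]; omega
  have e2 : Fin.castAdd 2 l ≠ Fin.castSucc (Fin.last m) := by
    have := l.2
    simp only [ne_eq, Fin.ext_iff, Fin.val_castAdd, Fin.val_last, Fin.val_castSucc]; omega
  simp only [Pi.sub_apply, Pi.single_eq_of_ne e1, Pi.single_eq_of_ne e2, sub_zero] at hl
  rw [Matrix.mulVec_smul, Pi.smul_apply]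
  change ((-1 : A) ^ (i : ℕ)) • (Y *ᵥ s) (Fin.castAdd 2 l) = _
  rw [← hl]
  simp only [Pi.single_apply, Fin.castAdd_inj]
  split_ifs
  · rw [smul_eq_mul, ← mul_assoc, h1, one_mul]
  · simp

theorem MinorsRegular.mem_subIdeal (h : MinorsRegular Y) {y : A}
    (hy : ∀ i, y * maxMinor Y i ∈ linkIdeal Y) : y ∈ subIdeal Y := by
  choose Z hZ using h.exists_mulVec_eq_single hy
  set X' := Y.submatrix (Fin.castAdd 2) id with hX'
  have hw : ∀ c, X' *ᵥ ((∑ i, X' i c • Z i) - Pi.single c y) = 0 := fun c => by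
    rw [Matrix.mulVec_sub, Matrix.mulVec_sum]
    simp only [Matrix.mulVec_smul, hZ]
    ext l
    simp [Finset.sum_apply, Pi.single_apply, mul_comm]
  have := fun c => exists_eq_smul_signedMinors X' 0 (Fin.last m) h.subVec_zero h.subVec_last (hw c)
  choose t ht using this
  have key : subVec Y 0 * (y + t ⬝ᵥ subVec Y) ∈ (⊥ : Ideal A) := by
    have h1 : ∑ c, subVec Y c * ((∑ i, X' i c • Z i) - Pi.single c y : Fin (m + 1) → A) 0
        = ∑ c, subVec Y c * (t c * subVec Y 0) :=
      Finset.sum_congr rfl fun c _ => by rw [ht c]; rfl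
    have h2 : ∑ c, subVec Y c * (∑ i, X' i c • Z i) 0 = 0 := by
      simp only [Finset.sum_apply, Pi.smul_apply, smul_eq_mul, Finset.mul_sum]
      rw [Finset.sum_comm]
      refine Finset.sum_eq_zero fun i _ => ?_
      have h3 := congrFun (mulVec_signedMinors X') i
      have h4 : ∑ c, X' i c * subVec Y c = 0 := h3
      calc _ = (∑ c, X' i c * subVec Y c) * Z i 0 := by
            rw [Finset.sum_mul]; exact Finset.sum_congr rfl fun _ _ => by ring
        _ = 0 := by rw [h4, zero_mul]
    simp only [Pi.sub_apply, mul_sub, Finset.sum_sub_distrib, h2, Pi.single_apply] at h1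
    simp only [mul_ite, mul_zero, Finset.sum_ite_eq, Finset.mem_univ, if_true] at h1
    rw [Ideal.mem_bot, mul_add, dotProduct, Finset.mul_sum]
    have h5 : ∑ i, subVec Y 0 * (t i * subVec Y i) = ∑ c, subVec Y c * (t c * subVec Y 0) :=
      Finset.sum_congr rfl fun _ _ => by ring
    rw [h5, ← h1]; simp
  have := h.subVec_zero _ key
  rw [Ideal.mem_bot] at this
  rw [eq_neg_of_add_eq_zero_left this]
  exact neg_mem (dotProduct_subVec_mem_subIdeal Y t)

theorem MinorsRegular.exists_vecMul_eq_subVec_smul (h : MinorsRegular Y) {w : Fin (m + 1) → A}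
    (hw : w ⬝ᵥ subVec Y ∈ maxIdeal Y) (j : Fin (m + 1)) : ∃ s, s ᵥ* Y = subVec Y j • w := by
  have h1 : ∀ x ∈ maxIdeal Y, ∀ w : Fin (m + 1) → A, ∃ s, s ᵥ* Y = x • w := by
    intro x hx w
    refine Submodule.span_induction (p := fun x _ => ∃ s, s ᵥ* Y = x • w) ?_ ?_ ?_ ?_ hx
    · rintro _ ⟨i, rfl⟩; exact exists_vecMul_eq_maxMinor_smul Y i w
    · exact ⟨0, by simp⟩
    · rintro x y _ _ ⟨s, hs⟩ ⟨t, ht⟩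
      exact ⟨s + t, by rw [Matrix.add_vecMul, hs, ht, add_smul]⟩
    · rintro c x _ ⟨s, hs⟩
      exact ⟨c • s, by rw [Matrix.smul_vecMul, hs, smul_assoc]⟩
  obtain ⟨s, hs⟩ := h1 _ hw (Pi.single j 1)
  obtain ⟨t, ht⟩ := exists_eq_vecMul_of_dotProduct_signedMinors (Y.submatrix (Fin.castAdd 2) id)
    0 (Fin.last m) h.subVec_zero h.subVec_last
    (w := subVec Y j • w - (w ⬝ᵥ subVec Y) • Pi.single j 1) (by
      change _ ⬝ᵥ subVec Y = 0
      simp only [sub_dotProduct, smul_dotProduct, single_dotProduct, smul_eq_mul]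
      ring)
  refine ⟨s + Fin.append t ![0, 0], ?_⟩
  have h2 : (Fin.append t ![0, 0] : Fin (m + 2) → A) ᵥ* Y =
      t ᵥ* Y.submatrix (Fin.castAdd 2) id := by
    ext c
    simp only [vecMul, dotProduct]
    rw [Fin.sum_univ_add]
    simp
  rw [Matrix.add_vecMul, hs, h2, ← ht]
  abel

theorem MinorsRegular.mem_linkIdeal (h : MinorsRegular Y) {x : A} (hx : x ∈ subIdeal Y)
    (hx' : x ∈ maxIdeal Y) : x ∈ linkIdeal Y := by
  obtain ⟨w, rfl⟩ := exists_dotProduct_subVec Y hx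
  obtain ⟨s, hs⟩ := h.exists_vecMul_eq_subVec_smul hx' 0
  obtain ⟨t, ht⟩ := h.exists_vecMul_eq_subVec_smul hx' (Fin.last m)
  set v := subVec Y 0 with hv
  set v' := subVec Y (Fin.last m) with hv'
  have hst : Yᵀ *ᵥ (v' • s - v • t) = 0 := by
    rw [Matrix.mulVec_transpose, Matrix.sub_vecMul, Matrix.smul_vecMul, Matrix.smul_vecMul, hs, ht,
      smul_comm, sub_self]
  obtain ⟨c, hc⟩ := exists_eq_smul_signedMinors Yᵀ _ _ h.transpose_last
    h.transpose_castSucc_last hst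
  have hspan : Ideal.span {subMinor Y 0, subMinor Y (Fin.last m)} = Ideal.span {v, v'} := by
    rw [Ideal.span_insert, Ideal.span_insert, hv, hv', subVec_apply, subVec_apply,
      span_singleton_neg_one_pow_mul, span_singleton_neg_one_pow_mul]
  have h0 : signedMinors Yᵀ 0 = maxMinor Y 0 := by rw [signedMinors_transpose]; simp
  have hreg := h.zero_of_sub
  rw [hspan] at hreg
  obtain ⟨β, α, hαβ⟩ := Ideal.mem_span_pair.1 (hreg c (by
    refine Ideal.mem_span_pair.2 ⟨-t 0, s 0, ?_⟩
    have := congrFun hc 0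
    simp only [Pi.sub_apply, Pi.smul_apply, smul_eq_mul, h0] at this
    linear_combination this))
  have h1 : ∀ l, ∃ r, s l - α * signedMinors Yᵀ l = v * r := fun l => by
    obtain ⟨r, hr⟩ := Ideal.mem_span_singleton'.1 (h.subVec_last
      (s l - α * signedMinors Yᵀ l) (Ideal.mem_span_singleton'.2
        ⟨t l + β * signedMinors Yᵀ l, by
          have := congrFun hc l
          simp only [Pi.sub_apply, Pi.smul_apply, smul_eq_mul] at this
          linear_combination -this + hαβ * signedMinors Yᵀ l⟩))
    exact ⟨r, by linear_combination -hr⟩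
  choose r hr using h1
  have h2 : v • r = s - α • signedMinors Yᵀ := funext fun l => (hr l).symm
  have h3 : w = r ᵥ* Y := by
    refine funext fun l => sub_eq_zero.1 (h.subVec_zero _ ?_)
    have h4 : (v • r) ᵥ* Y = v • w := by
      rw [h2, Matrix.sub_vecMul, Matrix.smul_vecMul, ← Matrix.mulVec_transpose Y (signedMinors _),
        mulVec_signedMinors, hs, smul_zero, sub_zero]
    rw [Matrix.smul_vecMul] at h4
    have := congrFun h4 l
    simp only [Pi.smul_apply, smul_eq_mul] at this
    rw [Ideal.mem_bot, mul_sub, this, sub_self]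
  rw [h3]
  exact dotProduct_subVec_mem_of_vecMul Y r

theorem maxMinor_map {B : Type*} [CommRing B] (f : A →+* B) (i : Fin (m + 2)) :
    maxMinor (Y.map f) i = f (maxMinor Y i) := by
  rw [maxMinor, maxMinor, RingHom.map_det]; rfl

theorem subMinor_map {B : Type*} [CommRing B] (f : A →+* B) (j : Fin (m + 1)) :
    subMinor (Y.map f) j = f (subMinor Y j) := by
  rw [subMinor, subMinor, RingHom.map_det]; rfl

theorem MinorsRegular.isRegularMod_maxIdeal (h : MinorsRegular Y) :
    IsRegularMod (maxIdeal Y) (subMinor Y 0) := by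
  set v := subMinor Y 0 with hv
  intro x hx
  obtain ⟨c, hc⟩ := Ideal.mem_span_range_iff_exists_fun.1 hx
  set J : Ideal A := Ideal.span {v}
  have hJ : ∀ {x}, Ideal.Quotient.mk J x = 0 ↔ x ∈ J := Ideal.Quotient.eq_zero_iff_mem
  set Y' := Y.map (Ideal.Quotient.mk J) with hY'
  have hs := signedMinors_transpose Y'
  obtain ⟨z, hz⟩ := exists_eq_vecMul_of_dotProduct_signedMinors Y'ᵀ 0 (Fin.last (m + 1))
    (by
      rw [hs, hY', maxMinor_map]
      refine isRegularMod_neg_one_pow_mul _ fun z => ?_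
      obtain ⟨z, rfl⟩ := Ideal.Quotient.mk_surjective z
      rw [← map_mul, Ideal.mem_bot, Ideal.mem_bot, hJ, hJ]
      exact h.zero_of_sub_zero z)
    (by
      rw [hs, hs, hY', maxMinor_map, maxMinor_map, span_singleton_neg_one_pow_mul]
      refine isRegularMod_neg_one_pow_mul _ fun z => ?_
      obtain ⟨z, rfl⟩ := Ideal.Quotient.mk_surjective z
      have : ∀ w, Ideal.Quotient.mk J w ∈ Ideal.span {Ideal.Quotient.mk J (maxMinor Y 0)} ↔
          w ∈ Ideal.span {v, maxMinor Y 0} := fun w => by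
        rw [← Set.image_singleton, ← Ideal.map_span, Ideal.mem_quotient_iff_mem_sup,
          Ideal.span_insert, sup_comm]
      rw [← map_mul, this, this]
      exact h.last_of_sub_zero z)
    (w := fun i => Ideal.Quotient.mk J ((-1) ^ (i : ℕ) * c i)) (by
      have h1 : ∀ n : ℕ, ((-1 : A) ^ n) * (-1) ^ n = 1 := fun n => by rw [← mul_pow]; simp
      simp only [dotProduct, hs]
      simp only [hY', maxMinor_map]
      calc _ = Ideal.Quotient.mk J (∑ i, c i * maxMinor Y i) := by
            rw [map_sum]
            refine Finset.sum_congr rfl fun i _ => ?_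
            have h2 : c i * maxMinor Y i
              = (-1) ^ (i : ℕ) * c i * ((-1) ^ (i : ℕ) * maxMinor Y i) := by
              linear_combination - c i * maxMinor Y i * h1 i
            rw [h2]; simp only [map_mul, map_pow, map_neg, map_one]
        _ = 0 := by
            rw [hc, hJ]; exact Ideal.mul_mem_right _ _ (Ideal.mem_span_singleton_self v))
  choose z' hz' using fun i => Ideal.Quotient.mk_surjective (I := J) (z i)
  have h1 : ∀ i : Fin (m + 2), ∃ d, (-1) ^ (i : ℕ) * c i - (Y *ᵥ z') i = v * d := fun i => by
    have h2 := congrFun hz i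
    rw [Matrix.vecMul_transpose] at h2
    have h3 : (Y' *ᵥ z) i = Ideal.Quotient.mk J ((Y *ᵥ z') i) := by
      simp [Matrix.mulVec, dotProduct, hY', hz']
    rw [h3, ← sub_eq_zero, ← map_sub, hJ] at h2
    obtain ⟨d, hd⟩ := Ideal.mem_span_singleton'.1 h2
    exact ⟨d, by rw [← hd, mul_comm]⟩
  choose d hd using h1
  have h2 : x - d ⬝ᵥ signedMinors Yᵀ ∈ (⊥ : Ideal A) := by
    refine h.subMinor_zero _ ?_
    have h3 : (Y *ᵥ z') ⬝ᵥ signedMinors Yᵀ = 0 := by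
      rw [← Matrix.vecMul_transpose, ← Matrix.dotProduct_mulVec, mulVec_signedMinors]; simp
    have h4 : ((fun i : Fin (m + 2) => (-1) ^ (i : ℕ) * c i) - Y *ᵥ z') ⬝ᵥ signedMinors Yᵀ
        = v * (d ⬝ᵥ signedMinors Yᵀ) := by
      rw [dotProduct, dotProduct, Finset.mul_sum]
      refine Finset.sum_congr rfl fun i _ => ?_
      simp only [Pi.sub_apply]; rw [hd]; ring
    have h5 : (fun i : Fin (m + 2) => (-1) ^ (i : ℕ) * c i) ⬝ᵥ signedMinors Yᵀ = v * x := by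
      rw [dotProduct, ← hc]
      refine Finset.sum_congr rfl fun i _ => ?_
      have h1 : ((-1 : A) ^ (i : ℕ)) * (-1) ^ (i : ℕ) = 1 := by rw [← mul_pow]; simp
      rw [signedMinors_transpose]
      linear_combination c i * maxMinor Y i * h1
    rw [sub_dotProduct, h3, h5, sub_zero] at h4
    rw [Ideal.mem_bot, ← hv, mul_sub, h4, sub_self]
  rw [Ideal.mem_bot, sub_eq_zero] at h2
  rw [h2]
  refine Ideal.sum_mem _ fun i _ => Ideal.mul_mem_left _ _ ?_
  rw [signedMinors_transpose]
  exact Ideal.mul_mem_left _ _ (Ideal.subset_span ⟨i, rfl⟩)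

end Linkage

section RegularMod

variable {A : Type*} [CommRing A] {J : Ideal A}

theorem isRegularMod_one : IsRegularMod J 1 := fun z hz => by rwa [one_mul] at hz

theorem IsRegularMod.mul {c d : A} (hc : IsRegularMod J c) (hd : IsRegularMod J d) :
    IsRegularMod J (c * d) := fun z hz => hd z (hc _ (by rwa [mul_assoc] at hz))

theorem IsRegularMod.pow {c : A} (hc : IsRegularMod J c) (n : ℕ) : IsRegularMod J (c ^ n) := by
  induction n with
  | zero => rw [pow_zero]; exact isRegularMod_one
  | succ n ih => rw [pow_succ]; exact ih.mul hc

theorem Ideal.IsPrime.isRegularMod (hJ : J.IsPrime) {c : A} (hc : c ∉ J) : IsRegularMod J c :=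
  fun _ hz => (hJ.mem_or_mem hz).resolve_left hc

theorem IsRegularMod.congr {c d : A} (h : c - d ∈ J) (hc : IsRegularMod J c) :
    IsRegularMod J d := fun z hz => hc z <| by
  have := J.add_mem (J.mul_mem_right z h) hz
  rwa [sub_mul, sub_add_cancel] at this

theorem sup_span_singleton_eq_of_sub_mem {c d : A} (h : c - d ∈ J) :
    J ⊔ Ideal.span {c} = J ⊔ Ideal.span {d} := by
  have key : ∀ {c d : A}, c - d ∈ J → J ⊔ Ideal.span {c} ≤ J ⊔ Ideal.span {d} := by
    intro c d h
    refine sup_le le_sup_left ((Ideal.span_singleton_le_iff_mem _).2 ?_)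
    rw [← sub_add_cancel c d]
    exact add_mem (Ideal.mem_sup_left h) (Ideal.mem_sup_right (Ideal.mem_span_singleton_self d))
  refine le_antisymm (key h) (key ?_)
  rw [← neg_sub]; exact neg_mem h

theorem mem_sup_span_singleton {x z : A} :
    z ∈ J ⊔ Ideal.span {x} ↔ ∃ w, z - x * w ∈ J := by
  rw [Submodule.mem_sup]
  constructor
  · rintro ⟨j, hj, y, hy, rfl⟩
    obtain ⟨w, rfl⟩ := Ideal.mem_span_singleton'.1 hy
    exact ⟨w, by rwa [mul_comm x w, add_sub_cancel_right]⟩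
  · rintro ⟨w, hw⟩
    exact ⟨_, hw, x * w, Ideal.mul_mem_right _ _ (Ideal.mem_span_singleton_self x), by ring⟩

/-- Regularity modulo a product, from regularity modulo the factors. -/
theorem IsRegularMod.sup_span_mul {x y c : A} (hx : IsRegularMod J x)
    (hxc : IsRegularMod (J ⊔ Ideal.span {x}) c) (hyc : IsRegularMod (J ⊔ Ideal.span {y}) c) :
    IsRegularMod (J ⊔ Ideal.span {x * y}) c := by
  intro z hz
  obtain ⟨v, hv⟩ := mem_sup_span_singleton.1 hz
  obtain ⟨w, hw⟩ := mem_sup_span_singleton.1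
    (hxc z (mem_sup_span_singleton.2 ⟨y * v, by rwa [← mul_assoc]⟩))
  have h1 : c * w ∈ J ⊔ Ideal.span {y} := by
    refine mem_sup_span_singleton.2 ⟨v, hx _ ?_⟩
    have := J.sub_mem hv (J.mul_mem_left c hw)
    convert this using 1; ring
  obtain ⟨t, ht⟩ := mem_sup_span_singleton.1 (hyc w h1)
  refine mem_sup_span_singleton.2 ⟨t, ?_⟩
  have := J.add_mem hw (J.mul_mem_left x ht)
  convert this using 1; ring

theorem isRegularMod_sup_span_one {c : A} : IsRegularMod (J ⊔ Ideal.span {1}) c := by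
  intro z _
  rw [Ideal.span_singleton_one, sup_top_eq]
  trivial

theorem isRegularMod_sup_span_pow {x c : A} (n : ℕ) (hx : IsRegularMod J x)
    (hxc : IsRegularMod (J ⊔ Ideal.span {x}) c) :
    IsRegularMod (J ⊔ Ideal.span {x ^ n}) c := by
  induction n with
  | zero => rw [pow_zero]; exact isRegularMod_sup_span_one
  | succ n ih => rw [pow_succ']; exact hx.sup_span_mul hxc ih

theorem isRegularMod_prod {ι : Type*} (S : Finset ι) (x : ι → A)
    (hx : ∀ i ∈ S, IsRegularMod J (x i)) : IsRegularMod J (∏ i ∈ S, x i) := by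
  classical
  induction S using Finset.induction_on with
  | empty => rw [Finset.prod_empty]; exact isRegularMod_one
  | insert i S hi ih =>
    rw [Finset.prod_insert hi]
    exact (hx i (Finset.mem_insert_self i S)).mul
      (ih fun j hj => hx j (Finset.mem_insert_of_mem hj))

theorem isRegularMod_sup_span_prod {ι : Type*} (S : Finset ι) (x : ι → A) (n : ℕ) {c : A}
    (hx : ∀ i ∈ S, IsRegularMod J (x i))
    (hxc : ∀ i ∈ S, IsRegularMod (J ⊔ Ideal.span {x i}) c) :
    IsRegularMod (J ⊔ Ideal.span {∏ i ∈ S, x i ^ n}) c := by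
  classical
  induction S using Finset.induction_on with
  | empty => rw [Finset.prod_empty]; exact isRegularMod_sup_span_one
  | insert i S hi ih =>
    rw [Finset.prod_insert hi]
    have hi' := Finset.mem_insert_self i S
    exact ((hx i hi').pow n).sup_span_mul (isRegularMod_sup_span_pow n (hx i hi') (hxc i hi'))
      (ih (fun j hj => hx j (Finset.mem_insert_of_mem hj))
        fun j hj => hxc j (Finset.mem_insert_of_mem hj))

theorem IsRegularMod.swap {x c : A} (hx : IsRegularMod J x)
    (hc : IsRegularMod (J ⊔ Ideal.span {x}) c) : IsRegularMod (J ⊔ Ideal.span {c}) x := by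
  intro z hz
  obtain ⟨w, hw⟩ := mem_sup_span_singleton.1 hz
  have h1 : c * w ∈ J ⊔ Ideal.span {x} := by
    refine mem_sup_span_singleton.2 ⟨z, ?_⟩
    rw [← neg_sub]; exact neg_mem hw
  obtain ⟨v, hv⟩ := mem_sup_span_singleton.1 (hc w h1)
  refine mem_sup_span_singleton.2 ⟨v, hx _ ?_⟩
  have := J.add_mem hw (J.mul_mem_left c hv)
  convert this using 1; ring

theorem IsRegularMod.of_sup_span [IsNoetherianRing A] {x c : A}
    (hxj : x ∈ Ideal.jacobson (⊥ : Ideal A))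
    (hx : IsRegularMod J x) (hc : IsRegularMod (J ⊔ Ideal.span {x}) c) : IsRegularMod J c := by
  let K : Ideal A := Submodule.comap (LinearMap.mulLeft A c) J
  have hK : ∀ z, z ∈ K ↔ c * z ∈ J := fun _ => Iff.rfl
  have key : K ≤ J := by
    refine Submodule.le_of_le_smul_of_le_jacobson_bot (I := Ideal.span {x})
      (IsNoetherian.noetherian _) ((Ideal.span_singleton_le_iff_mem _).2 hxj) ?_
    intro z hz
    have hz' : c * z ∈ J := hz
    obtain ⟨w, hw⟩ := mem_sup_span_singleton.1 (hc z (Ideal.mem_sup_left hz'))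
    rw [← sub_add_cancel z (x * w)]
    refine add_mem (Ideal.mem_sup_left hw) (Ideal.mem_sup_right ?_)
    refine Ideal.mul_mem_mul (Ideal.mem_span_singleton_self x) ((hK _).2 ?_)
    refine hx _ ?_
    have := J.sub_mem hz' (J.mul_mem_left c hw)
    convert this using 1; ring
  exact fun z hz => key hz

/-- `l` is a weakly regular sequence modulo `J`. -/
def RegularChain (J : Ideal A) : List A → Prop
  | [] => True
  | c :: l => IsRegularMod J c ∧ RegularChain (J ⊔ Ideal.span {c}) l

theorem RegularChain.of_sup_span [IsNoetherianRing A] {x : A}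
    (hxj : x ∈ Ideal.jacobson (⊥ : Ideal A)) {l : List A} (hx : IsRegularMod J x)
    (hl : RegularChain (J ⊔ Ideal.span {x}) l) : RegularChain J l := by
  induction l generalizing J with
  | nil => trivial
  | cons c l ih =>
    refine ⟨hx.of_sup_span hxj hl.1, ih (hx.swap hl.1) ?_⟩
    rw [sup_right_comm]
    exact hl.2

end RegularMod

section VariableIdeals

variable {σ : Type*} {k : Type*} [Field k]

open MvPowerSeries

/-- The ideal generated by the variables in `T`. -/
noncomputable def varIdeal (k : Type*) [Field k] (T : Set σ) : Ideal (MvPowerSeries σ k) :=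
  Ideal.span (X '' T)

theorem varIdeal_insert (t : σ) (T : Set σ) :
    varIdeal k (insert t T) = varIdeal k T ⊔ Ideal.span {X t} := by
  rw [varIdeal, Set.image_insert_eq, Ideal.span_insert, sup_comm, varIdeal]

theorem varIdeal_mono {T U : Set σ} (h : T ⊆ U) : varIdeal k T ≤ varIdeal k U :=
  Ideal.span_mono (Set.image_mono h)

theorem X_mem_varIdeal {t : σ} {T : Set σ} (h : t ∈ T) :
    (X t : MvPowerSeries σ k) ∈ varIdeal k T :=
  Ideal.subset_span ⟨t, h, rfl⟩

theorem coeff_eq_zero_of_mem_varIdeal {T : Set σ} {f : MvPowerSeries σ k}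
    (hf : f ∈ varIdeal k T) (d : σ →₀ ℕ) (hd : ∀ t ∈ T, d t = 0) : coeff d f = 0 := by
  induction hf using Submodule.span_induction generalizing d with
  | mem x hx =>
    obtain ⟨t, ht, rfl⟩ := hx
    exact X_dvd_iff.1 dvd_rfl d (hd t ht)
  | zero => simp
  | add x y _ _ hx hy => rw [map_add, hx d hd, hy d hd, add_zero]
  | smul a x _ hx =>
    classical
    rw [smul_eq_mul, coeff_mul]
    refine Finset.sum_eq_zero fun e he => ?_
    rw [hx e.2 fun t ht => ?_, mul_zero]
    have := DFunLike.congr_fun (Finset.HasAntidiagonal.mem_antidiagonal.1 he) t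
    rw [Finsupp.add_apply, hd t ht] at this
    omega

theorem mem_varIdeal_iff [Finite σ] {T : Set σ} {f : MvPowerSeries σ k} :
    f ∈ varIdeal k T ↔ ∀ d : σ →₀ ℕ, (∀ t ∈ T, d t = 0) → coeff d f = 0 := by
  refine ⟨coeff_eq_zero_of_mem_varIdeal, ?_⟩
  induction T, T.toFinite using Set.Finite.induction_on generalizing f with
  | empty =>
    intro h
    have : f = 0 := by ext d; exact h d (by simp)
    rw [this]; exact zero_mem _
  | @insert t T _ _ ih =>
    intro h
    classical
    let g : MvPowerSeries σ k := fun d => if d t = 0 then coeff d f else 0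
    have hg : ∀ d, coeff d g = if d t = 0 then coeff d f else 0 := fun d => rfl
    rw [varIdeal_insert, ← add_sub_cancel g f]
    refine add_mem (Ideal.mem_sup_left (ih fun d hd => ?_)) (Ideal.mem_sup_right ?_)
    · rw [hg]
      split_ifs with hdt
      · refine h d ?_
        rintro s (rfl | hs)
        · exact hdt
        · exact hd s hs
      · rfl
    · rw [Ideal.mem_span_singleton, X_dvd_iff]
      intro d hd
      rw [map_sub, hg, if_pos hd, sub_self]

theorem X_notMem_varIdeal {t : σ} {T : Set σ} (h : t ∉ T) :
    (X t : MvPowerSeries σ k) ∉ varIdeal k T := fun hm => by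
  classical
  have := coeff_eq_zero_of_mem_varIdeal hm (Finsupp.single t 1) fun s hs =>
    Finsupp.single_eq_of_ne (by rintro rfl; exact h hs)
  rw [coeff_index_single_self_X] at this
  exact one_ne_zero this

theorem varIdeal_isPrime [Finite σ] (T : Set σ) : (varIdeal k T).IsPrime := by
  classical
  let τ : MvPowerSeries σ k → MvPowerSeries σ k :=
    fun f d => if ∀ t ∈ T, d t = 0 then coeff d f else 0
  have hτ : ∀ f d, coeff d (τ f) = if ∀ t ∈ T, d t = 0 then coeff d f else 0 := fun _ _ => rfl
  have hsub : ∀ f, f - τ f ∈ varIdeal k T := fun f =>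
    mem_varIdeal_iff.2 fun d hd => by rw [map_sub, hτ, if_pos hd, sub_self]
  have hmem : ∀ f, τ f = 0 → f ∈ varIdeal k T := fun f h => by
    have := hsub f
    rwa [h, sub_zero] at this
  refine ⟨(Ideal.ne_top_iff_one _).2 fun h => ?_, fun {f g} h => ?_⟩
  · have := coeff_eq_zero_of_mem_varIdeal h 0 (by simp)
    simp at this
  · have h2 : τ f * τ g ∈ varIdeal k T := by
      have h3 := (varIdeal k T).sub_mem h (add_mem ((varIdeal k T).mul_mem_left f (hsub g))
        ((varIdeal k T).mul_mem_right (τ g) (hsub f)))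
      convert h3 using 1; ring
    have h3 : τ f * τ g = 0 := by
      ext d
      by_cases hd : ∀ t ∈ T, d t = 0
      · rw [coeff_eq_zero_of_mem_varIdeal h2 d hd, map_zero]
      · push Not at hd
        obtain ⟨t, ht, hdt⟩ := hd
        rw [coeff_mul, map_zero]
        refine Finset.sum_eq_zero fun x hx => ?_
        have hx' := DFunLike.congr_fun (Finset.HasAntidiagonal.mem_antidiagonal.1 hx) t
        rw [Finsupp.add_apply] at hx'
        rw [hτ, hτ]
        by_cases h1 : x.1 t = 0
        · rw [if_neg (c := ∀ t ∈ T, x.2 t = 0), mul_zero]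
          intro h; have := h t ht; omega
        · rw [if_neg, zero_mul]
          intro h; exact h1 (h t ht)
    rcases mul_eq_zero.1 h3 with h | h
    · exact Or.inl (hmem f h)
    · exact Or.inr (hmem g h)

theorem X_mem_jacobson (t : σ) :
    (X t : MvPowerSeries σ k) ∈ Ideal.jacobson (⊥ : Ideal (MvPowerSeries σ k)) := by
  rw [Ideal.mem_jacobson_bot]
  intro y
  rw [MvPowerSeries.isUnit_iff_constantCoeff]
  simp

theorem RegularChain.of_varIdeal [Finite σ] (T : Set σ) {l : List (MvPowerSeries σ k)}
    (h : RegularChain (varIdeal k T) l) : RegularChain ⊥ l := by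
  induction T, T.toFinite using Set.Finite.induction_on with
  | empty => rwa [varIdeal, Set.image_empty, Ideal.span_empty] at h
  | @insert t T ht _ ih =>
    rw [varIdeal_insert] at h
    have hx : IsRegularMod (varIdeal k T) (X t) :=
      (varIdeal_isPrime T).isRegularMod (X_notMem_varIdeal ht)
    have hj : (X t : MvPowerSeries σ k) ∈ Ideal.jacobson ⊥ := X_mem_jacobson t
    exact ih (RegularChain.of_sup_span hj hx h)

theorem regularChain_pair_of_prod_variables [Finite σ] {ι : Type*} (S : Finset ι) (s : ι → σ)
    (n : ℕ) {T U : Set σ} (hTU : T ⊆ U) (hs : ∀ i ∈ S, s i ∉ T) (hsU : ∀ i ∈ S, s i ∈ U)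
    {c d : MvPowerSeries σ k} (hc : c - ∏ i ∈ S, X (s i) ^ n ∈ varIdeal k T)
    (hd : d ∉ varIdeal k U) : RegularChain ⊥ [c, d] := by
  have hreg : ∀ i ∈ S, IsRegularMod (varIdeal k T) (X (s i)) :=
    fun i hi => (varIdeal_isPrime _).isRegularMod (X_notMem_varIdeal (hs i hi))
  refine RegularChain.of_varIdeal T ⟨?_, ?_, trivial⟩
  · refine (isRegularMod_prod S _ fun i hi => (hreg i hi).pow n).congr ?_
    rw [← neg_sub]
    exact neg_mem hc
  · rw [sup_span_singleton_eq_of_sub_mem hc]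
    refine isRegularMod_sup_span_prod S _ n hreg fun i hi => ?_
    rw [← varIdeal_insert]
    exact (varIdeal_isPrime _).isRegularMod fun h =>
      hd (varIdeal_mono (Set.insert_subset (hsU i hi) hTU) h)

theorem regularChain_of_prod_variables [Finite σ] {ι κ : Type*} (S : Finset ι) (S' : Finset κ)
    (s : ι → σ) (t : κ → σ) (n n' : ℕ) {T U : Set σ} (hTU : T ⊆ U) (hs : ∀ i ∈ S, s i ∉ T)
    (ht : ∀ j ∈ S', t j ∉ T) (hst : ∀ i ∈ S, ∀ j ∈ S', t j ≠ s i) (hsU : ∀ i ∈ S, s i ∈ U)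
    (htU : ∀ j ∈ S', t j ∈ U) {c d e : MvPowerSeries σ k}
    (hc : c - ∏ i ∈ S, X (s i) ^ n ∈ varIdeal k T)
    (hd : d - ∏ j ∈ S', X (t j) ^ n' ∈ varIdeal k T) (he : e ∉ varIdeal k U) :
    RegularChain ⊥ [c, d, e] := by
  have hreg : ∀ {T : Set σ} {s : σ}, s ∉ T → IsRegularMod (varIdeal k T) (X s) :=
    fun h => (varIdeal_isPrime _).isRegularMod (X_notMem_varIdeal h)
  have hneg : ∀ {f g : MvPowerSeries σ k} {J : Ideal (MvPowerSeries σ k)}, f - g ∈ J → g - f ∈ J :=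
    fun h => by rw [← neg_sub]; exact neg_mem h
  have hins : ∀ i ∈ S, ∀ j ∈ S', t j ∉ insert (s i) T := by
    rintro i hi j hj (h | h)
    · exact hst i hi j hj h
    · exact ht j hj h
  have hins' : ∀ i ∈ S, ∀ j ∈ S', s i ∉ insert (t j) T := by
    rintro i hi j hj (h | h)
    · exact hst i hi j hj h.symm
    · exact hs i hi h
  refine RegularChain.of_varIdeal T ⟨?_, ?_, ?_, trivial⟩
  · exact (isRegularMod_prod S _ fun i hi => (hreg (hs i hi)).pow n).congr (hneg hc)
  · rw [sup_span_singleton_eq_of_sub_mem hc]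
    refine isRegularMod_sup_span_prod S _ n (fun i hi => hreg (hs i hi)) fun i hi => ?_
    rw [← varIdeal_insert]
    exact (isRegularMod_prod S' _ fun j hj => (hreg (hins i hi j hj)).pow n').congr
      (varIdeal_mono (Set.subset_insert _ _) (hneg hd))
  · rw [sup_right_comm, sup_span_singleton_eq_of_sub_mem hd, sup_right_comm,
      sup_span_singleton_eq_of_sub_mem hc, sup_right_comm]
    refine isRegularMod_sup_span_prod S _ n (fun i hi => ?_) fun i hi => ?_
    · refine isRegularMod_sup_span_prod S' _ n' (fun j hj => hreg (ht j hj)) fun j hj => ?_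
      rw [← varIdeal_insert]
      exact hreg (hins' i hi j hj)
    · rw [sup_right_comm, ← varIdeal_insert]
      refine isRegularMod_sup_span_prod S' _ n' (fun j hj => hreg (hins i hi j hj)) fun j hj => ?_
      rw [← varIdeal_insert]
      refine (varIdeal_isPrime _).isRegularMod fun h => he (varIdeal_mono ?_ h)
      exact Set.insert_subset (htU j hj) (Set.insert_subset (hsU i hi) hTU)

end VariableIdeals

section Determinants

open Matrix

variable {A : Type*} [CommRing A] {J : Ideal A}

theorem det_sub_prod_mem_of_upper {n : ℕ} (M : Matrix (Fin n) (Fin n) A)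
    (h : ∀ i j, j < i → M i j ∈ J) : M.det - ∏ i, M i i ∈ J := by
  rw [← Ideal.Quotient.eq, RingHom.map_det, Matrix.det_of_isUpperTriangular, map_prod]
  · rfl
  · intro i j hij
    exact Ideal.Quotient.eq_zero_iff_mem.2 (h i j hij)

theorem det_sub_prod_mem_of_lower {n : ℕ} (M : Matrix (Fin n) (Fin n) A)
    (h : ∀ i j, i < j → M i j ∈ J) : M.det - ∏ i, M i i ∈ J := by
  rw [← Matrix.det_transpose]
  exact det_sub_prod_mem_of_upper Mᵀ fun i j hij => h j i hij

theorem det_notMem_of_perm {n : ℕ} (hJ : J.IsPrime) (M : Matrix (Fin n) (Fin n) A)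
    (e : Equiv.Perm (Fin n)) (h : ∀ i j, j ≠ e i → M i j ∈ J) (he : ∀ i, M i (e i) ∉ J) :
    M.det ∉ J := by
  intro hM
  have h1 : (M.submatrix id e).det ∈ J := by
    rw [Matrix.det_permute']; exact J.mul_mem_left _ hM
  have h2 := det_sub_prod_mem_of_upper (J := J) (M.submatrix id e) fun i j hij =>
    h i (e j) fun h => hij.ne (e.injective h)
  have h3 : ∏ i, M i (e i) ∈ J := by
    have := J.sub_mem h1 h2
    rwa [sub_sub_cancel] at this
  obtain ⟨i, _, hi⟩ := (Ideal.IsPrime.prod_mem_iff (hp := hJ)).1 h3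
  exact he i hi

end Determinants

section GenericMatrix

open Matrix

open MvPowerSeries

/-- The `n × (n - 1)` matrix of `q`-th powers of the variables. -/
noncomputable def powMatrix (k : Type*) [Field k] (m q : ℕ) :
    Matrix (Fin (m + 2)) (Fin (m + 1)) (MvPowerSeries (Fin (m + 2) × Fin (m + 1)) k) :=
  fun i j => X (i, j) ^ q

variable {k : Type*} [Field k] {m q : ℕ}

theorem powMatrix_mem (hq : q ≠ 0) {T : Set (Fin (m + 2) × Fin (m + 1))} {i : Fin (m + 2)}
    {j : Fin (m + 1)} (h : (i, j) ∈ T) : powMatrix k m q i j ∈ varIdeal k T :=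
  Ideal.pow_mem_of_mem _ (X_mem_varIdeal h) q (Nat.pos_of_ne_zero hq)

theorem powMatrix_notMem {T : Set (Fin (m + 2) × Fin (m + 1))} {i : Fin (m + 2)}
    {j : Fin (m + 1)} (h : (i, j) ∉ T) : powMatrix k m q i j ∉ varIdeal k T :=
  fun hm => X_notMem_varIdeal h ((varIdeal_isPrime T).mem_of_pow_mem q hm)

theorem val_castSucc_last_succAbove (i : Fin (m + 1)) :
    ((Fin.last m).castSucc.succAbove i : ℕ) = if (i : ℕ) = m then m + 1 else i := by
  have := i.2
  split_ifs with h
  · rw [Fin.succAbove_of_le_castSucc _ _ (by simp [Fin.le_def, h])]; simp [h]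
  · rw [Fin.succAbove_of_castSucc_lt _ _ (by simp [Fin.lt_def]; omega)]; simp

theorem val_finRotate_succ (i : Fin (m + 1)) :
    (finRotate (m + 1) i : ℕ) = if (i : ℕ) = m then 0 else (i : ℕ) + 1 := by
  rw [coe_finRotate]
  simp [Fin.ext_iff]

theorem regularChain_last_castSucc_last (hq : q ≠ 0) :
    RegularChain ⊥ [maxMinor (powMatrix k m q) (Fin.last (m + 1)),
      maxMinor (powMatrix k m q) (Fin.castSucc (Fin.last m))] := by
  set T : Set (Fin (m + 2) × Fin (m + 1)) :=
    {x | ¬ ((x.1 : ℕ) = x.2 ∨ (x.1 : ℕ) + 1 = x.2 ∨ ((x.1 : ℕ) = m + 1 ∧ (x.2 : ℕ) = 0))}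
  set U : Set (Fin (m + 2) × Fin (m + 1)) :=
    {x | ¬ ((x.1 : ℕ) + 1 = x.2 ∨ ((x.1 : ℕ) = m + 1 ∧ (x.2 : ℕ) = 0))}
  have hT : ∀ x, x ∈ T ↔
    ¬ ((x.1 : ℕ) = x.2 ∨ (x.1 : ℕ) + 1 = x.2 ∨ ((x.1 : ℕ) = m + 1 ∧ (x.2 : ℕ) = 0)) :=
    fun _ => Iff.rfl
  have hU : ∀ x, x ∈ U ↔ ¬ ((x.1 : ℕ) + 1 = x.2 ∨ ((x.1 : ℕ) = m + 1 ∧ (x.2 : ℕ) = 0)) :=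
    fun _ => Iff.rfl
  clear_value T U
  refine regularChain_pair_of_prod_variables (T := T) (U := U) Finset.univ
    (fun i : Fin (m + 1) => (i.castSucc, i)) q (fun x hx => ?_) (fun i _ => ?_) (fun i _ => ?_)
    ?_ ?_
  · rw [hT] at hx; rw [hU]; omega
  · simp [hT]
  · have := i.2
    simp only [hU, Fin.val_castSucc]; omega
  · rw [maxMinor, Fin.succAbove_last]
    refine det_sub_prod_mem_of_upper _ fun i j hij => powMatrix_mem hq ?_
    have := j.2
    have hij : (j : ℕ) < i := hij
    simp only [hT, Fin.val_castSucc, id]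
    omega
  · refine det_notMem_of_perm (varIdeal_isPrime U) _ (finRotate (m + 1))
      (fun i j hij => powMatrix_mem hq ?_) fun i => powMatrix_notMem ?_
    · have h1 := val_castSucc_last_succAbove i
      have h2 := val_finRotate_succ i
      have h3 : (j : ℕ) ≠ finRotate (m + 1) i := fun h => hij (Fin.ext h)
      have := i.2
      have := j.2
      simp only [hU, id]
      split_ifs at h1 h2 <;> omega
    · have h1 := val_castSucc_last_succAbove i
      have h2 := val_finRotate_succ i
      have := i.2
      simp only [hU, id]
      split_ifs at h1 h2 <;> omega

theorem regularChain_subMinor_zero (hq : q ≠ 0)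
    {e : MvPowerSeries (Fin (m + 2) × Fin (m + 1)) k}
    (he : e ∉ varIdeal k {x : Fin (m + 2) × Fin (m + 1) | (x.1 : ℕ) ≠ x.2}) :
    RegularChain ⊥ [subMinor (powMatrix k m q) 0, maxMinor (powMatrix k m q) 0, e] := by
  set T : Set (Fin (m + 2) × Fin (m + 1)) :=
    {x | ¬ ((x.1 : ℕ) = x.2 ∨ (x.1 : ℕ) + 1 = x.2 ∨ (x.1 : ℕ) = x.2 + 1)}
  refine regularChain_of_prod_variables (T := T) Finset.univ Finset.univ
    (fun i : Fin m => (Fin.castAdd 2 i, i.succ)) (fun i : Fin (m + 1) => (i.succ, i)) q q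
    (fun x hx => by simp only [T, Set.mem_ofPred_eq] at hx ⊢; omega) (fun i _ => by simp [T])
    (fun i _ => by simp [T]) (fun i _ j _ h => ?_) (fun i _ => by simp) (fun i _ => by simp)
    ?_ ?_ he
  · have h1 := congrArg (fun x => (x.1 : ℕ)) h
    have h2 := congrArg (fun x => (x.2 : ℕ)) h
    simp at h1 h2
    omega
  · refine det_sub_prod_mem_of_lower _ fun i j hij => powMatrix_mem hq ?_
    have hij : (i : ℕ) < j := hij
    simp only [Fin.succAbove_zero, T, Set.mem_ofPred_eq, Fin.val_castAdd, Fin.val_succ]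
    omega
  · refine det_sub_prod_mem_of_upper _ fun i j hij => powMatrix_mem hq ?_
    have hij : (j : ℕ) < i := hij
    simp only [Fin.succAbove_zero, T, Set.mem_ofPred_eq, id, Fin.val_succ]
    omega

theorem diag_notMem_varIdeal {n : ℕ} (hq : q ≠ 0) (r : Fin n → Fin (m + 2))
    (c : Fin n → Fin (m + 1)) (hr : ∀ i, (r i : ℕ) = i) (hc : ∀ i, (c i : ℕ) = i) :
    ((powMatrix k m q).submatrix r c).det ∉
      varIdeal k {x : Fin (m + 2) × Fin (m + 1) | (x.1 : ℕ) ≠ x.2} := by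
  refine det_notMem_of_perm (varIdeal_isPrime _) _ 1
      (fun i j hij => powMatrix_mem hq ?_) fun i => powMatrix_notMem ?_
  · have : (i : ℕ) ≠ j := fun h => hij (Fin.ext h.symm)
    simpa [hr, hc]
  · simp [hr, hc]

theorem constantCoeff_maxMinor_powMatrix (hq : q ≠ 0) (i : Fin (m + 2)) :
    constantCoeff (maxMinor (powMatrix k m q) i) = 0 := by
  rw [maxMinor, RingHom.map_det, Matrix.det_eq_zero_of_row_eq_zero 0]
  intro j
  simp [powMatrix, hq]

theorem mem_jacobson_of_constantCoeff {σ : Type*} {f : MvPowerSeries σ k}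
    (hf : constantCoeff f = 0) : f ∈ Ideal.jacobson (⊥ : Ideal (MvPowerSeries σ k)) := by
  rw [Ideal.mem_jacobson_bot]
  intro y
  rw [MvPowerSeries.isUnit_iff_constantCoeff]
  simp [hf]

theorem minorsRegular_powMatrix (hq : q ≠ 0) : MinorsRegular (powMatrix k m q) := by
  obtain ⟨h1, h2, -⟩ := regularChain_last_castSucc_last (k := k) (m := m) hq
  obtain ⟨h3, h4, h5, -⟩ := regularChain_subMinor_zero (k := k) (m := m) hq
    (e := subMinor (powMatrix k m q) (Fin.last m))
    (diag_notMem_varIdeal hq _ _ (fun i => by simp) fun i => by simp)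
  obtain ⟨-, -, h6, -⟩ := regularChain_subMinor_zero (k := k) (m := m) hq
    (e := maxMinor (powMatrix k m q) (Fin.last (m + 1)))
    (diag_notMem_varIdeal hq _ _ (fun i => by simp) fun i => by simp)
  have hj := mem_jacobson_of_constantCoeff
    (constantCoeff_maxMinor_powMatrix (k := k) (m := m) hq 0)
  rw [bot_sup_eq] at h2 h4 h5 h6
  refine ⟨h1, h2, h3, h4.of_sup_span hj h5, ?_, h4, ?_⟩
  · rw [Ideal.span_insert]
    exact h4.swap h5
  · rw [Ideal.span_insert]
    exact h6

end GenericMatrix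

section ExtOfCyclic

theorem Module.Projective.exists_comp_eq_of_range_le {R P M N : Type*} [Ring R] [AddCommGroup P]
    [Module R P] [AddCommGroup M] [Module R M] [AddCommGroup N] [Module R N]
    [Module.Projective R P] (f : M →ₗ[R] N) (g : P →ₗ[R] N)
    (h : ∀ x, ∃ y, f y = g x) : ∃ l : P →ₗ[R] M, ∀ x, f (l x) = g x := by
  obtain ⟨l, hl⟩ := Module.projective_lifting_property f.rangeRestrict
    (g.codRestrict (LinearMap.range f) h) f.surjective_rangeRestrict
  exact ⟨l, fun x => congrArg Subtype.val (LinearMap.congr_fun hl x)⟩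

variable {R : Type*} [CommRing R] {a b : R} {J : Ideal R}
  {P₀ P₁ P₂ P₃ : Type*} [AddCommGroup P₀] [Module R P₀] [AddCommGroup P₁] [Module R P₁]
  [AddCommGroup P₂] [Module R P₂] [AddCommGroup P₃] [Module R P₃]
  {ε : P₀ →ₗ[R] R ⧸ J} {d₁ : P₁ →ₗ[R] P₀} {d₂ : P₂ →ₗ[R] P₁} {d₃ : P₃ →ₗ[R] P₂}

theorem exists_eq_mul_of_mul_add_mul_eq_zero (ha : IsRegularMod ⊥ a)
    (hb : IsRegularMod (Ideal.span {a}) b) [Module.Projective R P₁] {s t : P₁ →ₗ[R] R}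
    (h : ∀ y, a * s y + b * t y = 0) :
    ∃ z : P₁ →ₗ[R] R, (∀ y, s y = b * z y) ∧ ∀ y, t y = -(a * z y) := by
  obtain ⟨z, hz⟩ := Module.Projective.exists_comp_eq_of_range_le
    (LinearMap.mulLeft R a) (-t) fun y => by
      obtain ⟨w, hw⟩ := Ideal.mem_span_singleton'.1 (hb (-t y) (Ideal.mem_span_singleton'.2
        ⟨s y, by linear_combination h y⟩))
      exact ⟨w, by rw [LinearMap.mulLeft_apply, mul_comm, hw]; rfl⟩
  have hz' : ∀ y, a * z y = -t y := hz
  refine ⟨z, fun y => ?_, fun y => by rw [hz' y, neg_neg]⟩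
  rw [← sub_eq_zero]
  exact ha _ (by rw [Ideal.mem_bot]; linear_combination h y - b * hz' y)

/-- A cochain `z` of degree two represents the element `c` of the colon ideal `(a, b) : J`. -/
def RepresentsColon (a b : R) (ε : P₀ →ₗ[R] R ⧸ J) (d₁ : P₁ →ₗ[R] P₀) (d₂ : P₂ →ₗ[R] P₁) (c : R)
    (z : P₂ →ₗ[R] R) : Prop :=
  ∃ (φ : P₀ →ₗ[R] R) (s t : P₁ →ₗ[R] R), (∀ y, φ (d₁ y) = a * s y + b * t y) ∧
    (∀ y, s (d₂ y) = b * z y) ∧ (∀ y, t (d₂ y) = -(a * z y)) ∧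
    ∀ x r, ε x = Ideal.Quotient.mk J r → φ x - c * r ∈ Ideal.span {a, b}

namespace RepresentsColon

theorem add {c c' : R} {z z' : P₂ →ₗ[R] R} (h : RepresentsColon a b ε d₁ d₂ c z)
    (h' : RepresentsColon a b ε d₁ d₂ c' z') :
    RepresentsColon a b ε d₁ d₂ (c + c') (z + z') := by
  obtain ⟨φ, s, t, h1, h2, h3, h4⟩ := h
  obtain ⟨φ', s', t', h1', h2', h3', h4'⟩ := h'
  refine ⟨φ + φ', s + s', t + t', fun y => ?_, fun y => ?_, fun y => ?_, fun x r hx => ?_⟩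
  · simp only [LinearMap.add_apply, h1, h1']; ring
  · simp only [LinearMap.add_apply, h2, h2']; ring
  · simp only [LinearMap.add_apply, h3, h3']; ring
  · convert add_mem (h4 x r hx) (h4' x r hx) using 1
    simp only [LinearMap.add_apply]; ring

theorem smul {c : R} {z : P₂ →ₗ[R] R} (r : R) (h : RepresentsColon a b ε d₁ d₂ c z) :
    RepresentsColon a b ε d₁ d₂ (r * c) (r • z) := by
  obtain ⟨φ, s, t, h1, h2, h3, h4⟩ := h
  refine ⟨r • φ, r • s, r • t, fun y => ?_, fun y => ?_, fun y => ?_, fun x r' hx => ?_⟩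
  · simp only [LinearMap.smul_apply, smul_eq_mul, h1]; ring
  · simp only [LinearMap.smul_apply, smul_eq_mul, h2]; ring
  · simp only [LinearMap.smul_apply, smul_eq_mul, h3]; ring
  · convert Ideal.mul_mem_left _ r (h4 x r' hx) using 1
    simp only [LinearMap.smul_apply, smul_eq_mul]; ring

theorem mul_mul {c : R} {z : P₂ →ₗ[R] R} (α β : R) (h : RepresentsColon a b ε d₁ d₂ c z) :
    RepresentsColon (a * α) (b * β) ε d₁ d₂ (α * β * c) z := by
  obtain ⟨φ, s, t, h1, h2, h3, h4⟩ := h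
  refine ⟨(α * β) • φ, β • s, α • t, fun y => ?_, fun y => ?_, fun y => ?_, fun x r hx => ?_⟩
  · simp only [LinearMap.smul_apply, smul_eq_mul, h1]; ring
  · simp only [LinearMap.smul_apply, smul_eq_mul, h2]; ring
  · simp only [LinearMap.smul_apply, smul_eq_mul, h3]; ring
  · obtain ⟨u, v, huv⟩ := Ideal.mem_span_pair.1 (h4 x r hx)
    refine Ideal.mem_span_pair.2 ⟨β * u, α * v, ?_⟩
    simp only [LinearMap.smul_apply, smul_eq_mul]
    linear_combination (α * β) * huv

theorem comp {J' : Ideal R} {Q₀ Q₁ Q₂ : Type*} [AddCommGroup Q₀] [Module R Q₀] [AddCommGroup Q₁]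
    [Module R Q₁] [AddCommGroup Q₂] [Module R Q₂] {ε' : Q₀ →ₗ[R] R ⧸ J'} {d₁' : Q₁ →ₗ[R] Q₀}
    {d₂' : Q₂ →ₗ[R] Q₁} (F₀ : Q₀ →ₗ[R] P₀) (F₁ : Q₁ →ₗ[R] P₁) (F₂ : Q₂ →ₗ[R] P₂)
    (hε : ∀ x r, ε' x = Ideal.Quotient.mk J' r → ε (F₀ x) = Ideal.Quotient.mk J r)
    (h₁ : ∀ y, d₁ (F₁ y) = F₀ (d₁' y)) (h₂ : ∀ y, d₂ (F₂ y) = F₁ (d₂' y))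
    {c : R} {z : P₂ →ₗ[R] R} (h : RepresentsColon a b ε d₁ d₂ c z) :
    RepresentsColon a b ε' d₁' d₂' c (z ∘ₗ F₂) := by
  obtain ⟨φ, s, t, h1, h2, h3, h4⟩ := h
  refine ⟨φ ∘ₗ F₀, s ∘ₗ F₁, t ∘ₗ F₁, fun y => ?_, fun y => ?_, fun y => ?_, fun x r hx => ?_⟩
  · simp only [LinearMap.comp_apply, ← h₁, h1]
  · simp only [LinearMap.comp_apply, ← h₂, h2]
  · simp only [LinearMap.comp_apply, ← h₂, h3]
  · exact h4 _ _ (hε x r hx)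

end RepresentsColon

variable (hε : Function.Surjective ε) (h₁ : ∀ x, ε x = 0 ↔ ∃ y, d₁ y = x)
  (h₂ : ∀ x, d₁ x = 0 ↔ ∃ y, d₂ y = x) (h₃ : ∀ x, d₂ x = 0 ↔ ∃ y, d₃ y = x)

include h₁

theorem smul_eq_of_mem {x : R} (hx : x ∈ J) (y : P₀) : ∃ w, d₁ w = x • y := by
  rw [← h₁, map_smul]
  obtain ⟨r, hr⟩ := Ideal.Quotient.mk_surjective (ε y)
  rw [← hr, ← Ideal.Quotient.mk_eq_mk, ← Submodule.Quotient.mk_smul, Submodule.Quotient.mk_eq_zero]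
  exact J.mul_mem_right _ hx

include h₂

theorem exists_comp_eq_smul_one {x : R} (hx : x ∈ J) [Module.Projective R P₀]
    [Module.Projective R P₁] (g : P₁ →ₗ[R] R) (hg : ∀ y, g (d₂ y) = 0) :
    ∃ h : P₀ →ₗ[R] R, ∀ y, h (d₁ y) = x * g y := by
  obtain ⟨k₀, hk₀⟩ := Module.Projective.exists_comp_eq_of_range_le d₁ (LinearMap.lsmul R P₀ x)
    (smul_eq_of_mem h₁ hx)
  obtain ⟨k₁, hk₁⟩ := Module.Projective.exists_comp_eq_of_range_le d₂
    (LinearMap.lsmul R P₁ x - k₀ ∘ₗ d₁) fun y => by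
      rw [← h₂]; simp [hk₀]
  refine ⟨g ∘ₗ k₀, fun y => ?_⟩
  have := hg (k₁ y)
  rw [hk₁] at this
  simp only [LinearMap.sub_apply, LinearMap.lsmul_apply, map_sub, map_smul, smul_eq_mul,
    LinearMap.comp_apply] at this ⊢
  linear_combination -this

include h₃ in
theorem exists_comp_eq_smul_two {x : R} (hx : x ∈ J) [Module.Projective R P₀]
    [Module.Projective R P₁] [Module.Projective R P₂] (g : P₂ →ₗ[R] R) (hg : ∀ y, g (d₃ y) = 0) :
    ∃ h : P₁ →ₗ[R] R, ∀ y, h (d₂ y) = x * g y := by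
  obtain ⟨k₀, hk₀⟩ := Module.Projective.exists_comp_eq_of_range_le d₁ (LinearMap.lsmul R P₀ x)
    (smul_eq_of_mem h₁ hx)
  have h₂' : ∀ y, d₁ (d₂ y) = 0 := fun y => (h₂ _).2 ⟨y, rfl⟩
  obtain ⟨k₁, hk₁⟩ := Module.Projective.exists_comp_eq_of_range_le d₂
    (LinearMap.lsmul R P₁ x - k₀ ∘ₗ d₁) fun y => by
      rw [← h₂]; simp [hk₀]
  obtain ⟨k₂, hk₂⟩ := Module.Projective.exists_comp_eq_of_range_le d₃
    (LinearMap.lsmul R P₂ x - k₁ ∘ₗ d₂) fun y => by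
      rw [← h₃]; simp [hk₁, h₂']
  refine ⟨g ∘ₗ k₁, fun y => ?_⟩
  have := hg (k₂ y)
  rw [hk₂] at this
  simp only [LinearMap.sub_apply, LinearMap.lsmul_apply, map_sub, map_smul, smul_eq_mul,
    LinearMap.comp_apply] at this ⊢
  linear_combination -this

theorem exists_comp_eq_of_regular (ha : IsRegularMod ⊥ a) (hb : IsRegularMod (Ideal.span {a}) b)
    (haJ : a ∈ J) (hbJ : b ∈ J) [Module.Projective R P₀] [Module.Projective R P₁]
    (w : P₁ →ₗ[R] R) (hw : ∀ y, w (d₂ y) = 0) : ∃ φ : P₀ →ₗ[R] R, ∀ y, φ (d₁ y) = w y := by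
  obtain ⟨f, hf⟩ := exists_comp_eq_smul_one h₁ h₂ haJ w hw
  obtain ⟨φ, hφ⟩ := Module.Projective.exists_comp_eq_of_range_le (LinearMap.mulLeft R a) f
    fun x => by
      obtain ⟨y, hy⟩ := smul_eq_of_mem h₁ hbJ x
      obtain ⟨v, hv⟩ := Ideal.mem_span_singleton'.1 (hb (f x) (Ideal.mem_span_singleton'.2
        ⟨w y, by rw [mul_comm, ← hf, hy, map_smul, smul_eq_mul]⟩))
      exact ⟨v, by rw [LinearMap.mulLeft_apply, mul_comm, hv]⟩
  refine ⟨φ, fun y => ?_⟩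
  rw [← sub_eq_zero]
  refine ha _ ?_
  have : a * φ (d₁ y) = f (d₁ y) := hφ _
  rw [Ideal.mem_bot, mul_sub, this, hf, sub_self]

include h₃ in
theorem exists_representsColon (ha : IsRegularMod ⊥ a) (hb : IsRegularMod (Ideal.span {a}) b)
    [Module.Projective R P₀] [Module.Projective R P₁] [Module.Projective R P₂] {c : R}
    (hc : ∀ x ∈ J, c * x ∈ Ideal.span {a, b}) :
    ∃ z, RepresentsColon a b ε d₁ d₂ c z ∧ ∀ y, z (d₃ y) = 0 := by
  obtain ⟨φ, hφ⟩ := Module.projective_lifting_property (Submodule.mkQ (Ideal.span {a, b}))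
    ((Submodule.mapQ J (Ideal.span {a, b}) (LinearMap.mulLeft R c) hc) ∘ₗ ε)
    (Submodule.mkQ_surjective _)
  have hφ' : ∀ x r, ε x = Ideal.Quotient.mk J r → φ x - c * r ∈ Ideal.span {a, b} := by
    intro x r hx
    have := LinearMap.congr_fun hφ x
    rw [LinearMap.comp_apply, LinearMap.comp_apply, hx] at this
    exact (Submodule.Quotient.eq _).1 this
  obtain ⟨u, hu⟩ := Module.Projective.exists_comp_eq_of_range_le
    (LinearMap.coprod (LinearMap.mulLeft R a) (LinearMap.mulLeft R b)) (φ ∘ₗ d₁) fun y => by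
      have := hφ' (d₁ y) 0 (by rw [map_zero]; exact (h₁ _).2 ⟨y, rfl⟩)
      rw [mul_zero, sub_zero] at this
      obtain ⟨α, β, h⟩ := Ideal.mem_span_pair.1 this
      exact ⟨(α, β), by simp only [LinearMap.coprod_apply, LinearMap.mulLeft_apply,
        LinearMap.comp_apply, ← h]; ring⟩
  have hu' : ∀ y, a * (u y).1 + b * (u y).2 = φ (d₁ y) := hu
  obtain ⟨z, hz1, hz2⟩ := exists_eq_mul_of_mul_add_mul_eq_zero ha hb
    (s := LinearMap.fst R R R ∘ₗ u ∘ₗ d₂) (t := LinearMap.snd R R R ∘ₗ u ∘ₗ d₂) fun y => by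
      have := hu' (d₂ y)
      rwa [(h₂ _).2 ⟨y, rfl⟩, map_zero] at this
  refine ⟨z, ⟨φ, LinearMap.fst R R R ∘ₗ u, LinearMap.snd R R R ∘ₗ u, fun y => (hu' y).symm, hz1,
    hz2, hφ'⟩, fun y => ha _ ?_⟩
  rw [Ideal.mem_bot, ← neg_eq_zero, ← hz2]
  have : d₂ (d₃ y) = 0 := (h₃ _).2 ⟨y, rfl⟩
  simp [this]

include hε h₃ in
theorem exists_representsColon_of_cocycle (ha : IsRegularMod ⊥ a)
    (hb : IsRegularMod (Ideal.span {a}) b) (haJ : a ∈ J) (hbJ : b ∈ J)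
    [Module.Projective R P₀] [Module.Projective R P₁] [Module.Projective R P₂]
    (z : P₂ →ₗ[R] R) (hz : ∀ y, z (d₃ y) = 0) :
    ∃ c, (∀ x ∈ J, c * x ∈ Ideal.span {a, b}) ∧ RepresentsColon a b ε d₁ d₂ c z := by
  obtain ⟨s, hs⟩ := exists_comp_eq_smul_two h₁ h₂ h₃ hbJ z hz
  obtain ⟨t, ht⟩ := exists_comp_eq_smul_two h₁ h₂ h₃ haJ (-z) fun y => by
    rw [LinearMap.neg_apply, hz, neg_zero]
  have ht : ∀ y, t (d₂ y) = -(a * z y) := fun y => by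
    rw [ht, LinearMap.neg_apply, mul_neg]
  obtain ⟨φ, hφ⟩ := exists_comp_eq_of_regular h₁ h₂ ha hb haJ hbJ (a • s + b • t) fun y => by
    simp only [LinearMap.add_apply, LinearMap.smul_apply, smul_eq_mul, hs, ht]; ring
  have hφ : ∀ y, φ (d₁ y) = a * s y + b * t y := hφ
  have hmem : ∀ x, ε x = 0 → φ x ∈ Ideal.span {a, b} := fun x hx => by
    obtain ⟨y, rfl⟩ := (h₁ x).1 hx
    exact Ideal.mem_span_pair.2 ⟨s y, t y, by rw [hφ]; ring⟩
  obtain ⟨x₀, hx₀⟩ := hε (Ideal.Quotient.mk J 1)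
  have hx₀' : ∀ r : R, ε (r • x₀) = Ideal.Quotient.mk J r := fun r => by
    rw [map_smul, hx₀, ← Ideal.Quotient.mk_eq_mk, ← Submodule.Quotient.mk_smul, smul_eq_mul,
      mul_one, Ideal.Quotient.mk_eq_mk]
  refine ⟨φ x₀, fun x hx => ?_, φ, s, t, hφ, hs, ht, fun x r hx => ?_⟩
  · rw [mul_comm, ← smul_eq_mul, ← map_smul]
    exact hmem _ (by rw [hx₀']; exact Ideal.Quotient.eq_zero_iff_mem.2 hx)
  · rw [mul_comm, ← smul_eq_mul, ← map_smul, ← map_sub]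
    exact hmem _ (by rw [map_sub, hx, hx₀', sub_self])

include hε in
theorem RepresentsColon.mem_of_coboundary (ha : IsRegularMod ⊥ a)
    (hb : IsRegularMod (Ideal.span {a}) b) (haJ : a ∈ J) (hbJ : b ∈ J)
    [Module.Projective R P₀] [Module.Projective R P₁] {c : R} {z : P₂ →ₗ[R] R}
    (h : RepresentsColon a b ε d₁ d₂ c z) (g : P₁ →ₗ[R] R) (hg : ∀ y, g (d₂ y) = z y) :
    c ∈ Ideal.span {a, b} := by
  obtain ⟨φ, s, t, hφ, hs, ht, hc⟩ := h
  obtain ⟨σ, hσ⟩ := exists_comp_eq_of_regular h₁ h₂ ha hb haJ hbJ (s - b • g) fun y => by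
    simp only [LinearMap.sub_apply, LinearMap.smul_apply, smul_eq_mul, hs, hg]; ring
  obtain ⟨τ, hτ⟩ := exists_comp_eq_of_regular h₁ h₂ ha hb haJ hbJ (t + a • g) fun y => by
    simp only [LinearMap.add_apply, LinearMap.smul_apply, smul_eq_mul, ht, hg]; ring
  simp only [LinearMap.sub_apply, LinearMap.add_apply, LinearMap.smul_apply, smul_eq_mul] at hσ hτ
  obtain ⟨x₀, hx₀⟩ := hε (Ideal.Quotient.mk J 1)
  obtain ⟨y, hy⟩ := smul_eq_of_mem h₁ haJ x₀
  have h0 : φ x₀ - (a * σ x₀ + b * τ x₀) = 0 := ha _ <| by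
    have e1 := congrArg φ hy
    have e2 := congrArg σ hy
    have e3 := congrArg τ hy
    rw [hφ, map_smul, smul_eq_mul] at e1
    rw [hσ, map_smul, smul_eq_mul] at e2
    rw [hτ, map_smul, smul_eq_mul] at e3
    rw [Ideal.mem_bot]
    linear_combination -e1 + a * e2 + b * e3
  have h1 := hc x₀ 1 hx₀
  rw [mul_one] at h1
  have h2 : φ x₀ ∈ Ideal.span {a, b} :=
    Ideal.mem_span_pair.2 ⟨σ x₀, τ x₀, by linear_combination -h0⟩
  simpa using sub_mem h2 h1

omit h₁ h₂ in
theorem RepresentsColon.exists_coboundary (hd : ∀ y, d₁ (d₂ y) = 0) (ha : IsRegularMod ⊥ a)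
    (hb : IsRegularMod (Ideal.span {a}) b) [Module.Projective R P₀] [Module.Projective R P₁]
    {c : R} {z : P₂ →ₗ[R] R} (h : RepresentsColon a b ε d₁ d₂ c z) (hc : c ∈ Ideal.span {a, b}) :
    ∃ g : P₁ →ₗ[R] R, ∀ y, g (d₂ y) = z y := by
  obtain ⟨φ, s, t, hφ, hs, ht, hc'⟩ := h
  obtain ⟨u, hu⟩ := Module.Projective.exists_comp_eq_of_range_le
    (LinearMap.coprod (LinearMap.mulLeft R a) (LinearMap.mulLeft R b)) φ fun x => by
      obtain ⟨r, hr⟩ := Ideal.Quotient.mk_surjective (ε x)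
      have := add_mem (hc' x r hr.symm) (Ideal.mul_mem_right r _ hc)
      rw [sub_add_cancel] at this
      obtain ⟨α, β, h⟩ := Ideal.mem_span_pair.1 this
      exact ⟨(α, β), by simp only [LinearMap.coprod_apply, LinearMap.mulLeft_apply, ← h]; ring⟩
  have hu' : ∀ x, a * (u x).1 + b * (u x).2 = φ x := hu
  obtain ⟨g, hg1, hg2⟩ := exists_eq_mul_of_mul_add_mul_eq_zero ha hb
    (s := s - LinearMap.fst R R R ∘ₗ u ∘ₗ d₁) (t := t - LinearMap.snd R R R ∘ₗ u ∘ₗ d₁)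
    fun y => by
      simp only [LinearMap.sub_apply, LinearMap.comp_apply, LinearMap.fst_apply,
        LinearMap.snd_apply]
      linear_combination -hφ y - hu' (d₁ y)
  refine ⟨g, fun y => ?_⟩
  have := hg2 (d₂ y)
  simp only [LinearMap.sub_apply, LinearMap.comp_apply, hd, map_zero, sub_zero, ht] at this
  rw [← sub_eq_zero]
  exact ha _ (by rw [Ideal.mem_bot]; linear_combination this)

end ExtOfCyclic

section ExtClass

open CategoryTheory Opposite

universe u

variable {R : Type u} [CommRing R]

theorem ModuleCat.unop_exact {S : ShortComplex (ModuleCat.{u} R)ᵒᵖ} (hS : S.Exact)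
    (x : S.X₂.unop) : S.f.unop x = 0 ↔ ∃ y, S.g.unop y = x := by
  refine ⟨fun h => ?_, ?_⟩
  · exact (ShortComplex.moduleCat_exact_iff _).1 hS.unop x h
  · rintro ⟨y, rfl⟩
    have := congrArg Quiver.Hom.unop S.zero
    exact ConcreteCategory.congr_hom this y

/-- The complex computing `Ext` into `Y`, as a chain complex in the opposite category. -/
noncomputable abbrev homComplex {M : ModuleCat.{u} R} (P : ProjectiveResolution M)
    (Y : ModuleCat.{u} R) : ChainComplex (ModuleCat.{u} R)ᵒᵖ ℕ :=
  ((((linearYoneda R (ModuleCat.{u} R)).obj Y).rightOp).mapHomologicalComplex _).obj P.complex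

/-- The cocycle `z` on the projective resolution `P` represents the class `h` in `Ext²`. -/
def IsExtClass {M : ModuleCat.{u} R} (P : ProjectiveResolution M) {Y : ModuleCat.{u} R}
    (z : P.complex.X 2 ⟶ Y) (h : ((Ext R (ModuleCat.{u} R) 2).obj (op M)).obj Y) : Prop :=
  ∃ w : ((homComplex P Y).opcycles 2).unop,
    ((homComplex P Y).pOpcycles 2).unop w = z ∧
      (P.isoLeftDerivedObj ((linearYoneda R (ModuleCat.{u} R)).obj Y).rightOp 2).hom.unop
        (((homComplex P Y).homologyι 2).unop w) = h

variable {M : ModuleCat.{u} R} (P : ProjectiveResolution M) {Y : ModuleCat.{u} R}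

namespace IsExtClass

theorem pOpcycles_injective :
    Function.Injective ((homComplex P Y).pOpcycles 2).unop := by
  rw [← ModuleCat.mono_iff_injective]
  infer_instance

theorem homologyι_surjective :
    Function.Surjective ((homComplex P Y).homologyι 2).unop := by
  rw [← ModuleCat.epi_iff_surjective]
  infer_instance

theorem iso_bijective :
    Function.Bijective
      (P.isoLeftDerivedObj ((linearYoneda R (ModuleCat.{u} R)).obj Y).rightOp 2).hom.unop := by
  rw [← ConcreteCategory.isIso_iff_bijective]
  infer_instance

theorem exists_of_cocycle (z : P.complex.X 2 ⟶ Y) (hz : P.complex.d 3 2 ≫ z = 0) :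
    ∃ h, IsExtClass P z h := by
  have hS := ShortComplex.exact_of_g_is_cokernel
    (ShortComplex.mk ((homComplex P Y).d 3 2) ((homComplex P Y).pOpcycles 2)
      (HomologicalComplex.d_pOpcycles _ _ _))
    ((homComplex P Y).opcyclesIsCokernel 3 2 (by simp))
  obtain ⟨w, hw⟩ := (ModuleCat.unop_exact hS z).1 hz
  exact ⟨_, w, hw, rfl⟩

variable {P}

theorem cocycle {z : P.complex.X 2 ⟶ Y} {h : ((Ext R (ModuleCat.{u} R) 2).obj (op M)).obj Y}
    (hz : IsExtClass P z h) : P.complex.d 3 2 ≫ z = 0 := by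
  have hS := ShortComplex.exact_of_g_is_cokernel
    (ShortComplex.mk ((homComplex P Y).d 3 2) ((homComplex P Y).pOpcycles 2)
      (HomologicalComplex.d_pOpcycles _ _ _))
    ((homComplex P Y).opcyclesIsCokernel 3 2 (by simp))
  obtain ⟨w, hw, -⟩ := hz
  exact (ModuleCat.unop_exact hS z).2 ⟨w, hw⟩

variable (P) in
theorem exists_cocycle (h : ((Ext R (ModuleCat.{u} R) 2).obj (op M)).obj Y) :
    ∃ z, IsExtClass P z h := by
  obtain ⟨v, hv⟩ := (iso_bijective P).2 h
  obtain ⟨w, rfl⟩ := homologyι_surjective P v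
  exact ⟨_, w, rfl, hv⟩

theorem add {z z' : P.complex.X 2 ⟶ Y} {h h' : ((Ext R (ModuleCat.{u} R) 2).obj (op M)).obj Y}
    (hz : IsExtClass P z h) (hz' : IsExtClass P z' h') : IsExtClass P (z + z') (h + h') := by
  obtain ⟨w, rfl, rfl⟩ := hz
  obtain ⟨w', rfl, rfl⟩ := hz'
  refine ⟨w + w', map_add _ _ _, ?_⟩
  exact (congrArg _ (map_add ((homComplex P Y).homologyι 2).unop.hom w w')).trans
    (map_add (P.isoLeftDerivedObj
      ((linearYoneda R (ModuleCat.{u} R)).obj Y).rightOp 2).hom.unop.hom _ _)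

theorem smul {z : P.complex.X 2 ⟶ Y} {h : ((Ext R (ModuleCat.{u} R) 2).obj (op M)).obj Y} (r : R)
    (hz : IsExtClass P z h) : IsExtClass P (r • z) (r • h) := by
  obtain ⟨w, rfl, rfl⟩ := hz
  refine ⟨r • w, map_smul _ _ _, ?_⟩
  exact (congrArg _ (map_smul ((homComplex P Y).homologyι 2).unop.hom r w)).trans
    (map_smul (P.isoLeftDerivedObj
      ((linearYoneda R (ModuleCat.{u} R)).obj Y).rightOp 2).hom.unop.hom _ _)

theorem eq_zero_iff {z : P.complex.X 2 ⟶ Y} {h : ((Ext R (ModuleCat.{u} R) 2).obj (op M)).obj Y}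
    (hz : IsExtClass P z h) : h = 0 ↔ ∃ g : P.complex.X 1 ⟶ Y, P.complex.d 2 1 ≫ g = z := by
  have hS := ShortComplex.exact_of_f_is_kernel
    (ShortComplex.mk ((homComplex P Y).homologyι 2) ((homComplex P Y).fromOpcycles 2 1) (by simp))
    ((homComplex P Y).homologyIsKernel 2 1 (by simp))
  have hp : ∀ g : P.complex.X 1 ⟶ Y, ((homComplex P Y).pOpcycles 2).unop
      (((homComplex P Y).fromOpcycles 2 1).unop g) = P.complex.d 2 1 ≫ g := fun g =>
    ConcreteCategory.congr_hom (congrArg Quiver.Hom.unop ((homComplex P Y).p_fromOpcycles 2 1)) g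
  obtain ⟨w, rfl, rfl⟩ := hz
  have h0 := ModuleCat.unop_exact hS w
  refine (((injective_iff_map_eq_zero' (P.isoLeftDerivedObj
    ((linearYoneda R (ModuleCat.{u} R)).obj Y).rightOp 2).hom.unop.hom).1
      (iso_bijective P).1 _).trans h0).trans ⟨?_, ?_⟩
  · rintro ⟨g, rfl⟩
    exact ⟨g, (hp g).symm⟩
  · rintro ⟨g, hg⟩
    exact ⟨g, pOpcycles_injective P ((hp g).trans hg)⟩

theorem map {N : ModuleCat.{u} R} {Q : ProjectiveResolution N} (f : N ⟶ M)
    (F : Q.complex ⟶ P.complex) (comm : F.f 0 ≫ P.π.f 0 = Q.π.f 0 ≫ f)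
    {z : P.complex.X 2 ⟶ Y} {h : ((Ext R (ModuleCat.{u} R) 2).obj (op M)).obj Y}
    (hz : IsExtClass P z h) :
    IsExtClass Q (F.f 2 ≫ z) ((((Ext R (ModuleCat.{u} R) 2).map f.op).app Y) h) := by
  set G := ((linearYoneda R (ModuleCat.{u} R)).obj Y).rightOp
  set F' := (G.mapHomologicalComplex (ComplexShape.down ℕ)).map F
  obtain ⟨w, rfl, rfl⟩ := hz
  refine ⟨(HomologicalComplex.opcyclesMap F' 2).unop w, ?_, ?_⟩
  · exact ConcreteCategory.congr_hom (congrArg Quiver.Hom.unop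
      (HomologicalComplex.p_opcyclesMap F' 2)) w
  · have h1 := ConcreteCategory.congr_hom (congrArg Quiver.Hom.unop
      (HomologicalComplex.homologyι_naturality F' 2)) w
    have h2 := ConcreteCategory.congr_hom (congrArg Quiver.Hom.unop
      (ProjectiveResolution.isoLeftDerivedObj_hom_naturality f Q P F comm G 2))
        (((homComplex P Y).homologyι 2).unop w)
    refine Eq.trans ?_ h2.symm
    exact congrArg (Q.isoLeftDerivedObj G 2).hom.unop h1.symm

end IsExtClass

end ExtClass

section ExtColon

open CategoryTheory Opposite

universe u

variable {R : Type u} [CommRing R]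

section Resolution

variable {J : Ideal R} (P : ProjectiveResolution (ModuleCat.of R (R ⧸ J)))

namespace CategoryTheory.ProjectiveResolution

/-- The augmentation of a projective resolution of `R ⧸ J`. -/
noncomputable def augmentation : P.complex.X 0 →ₗ[R] R ⧸ J :=
  (P.π.f 0).hom

theorem augmentation_surjective : Function.Surjective P.augmentation :=
  (ModuleCat.epi_iff_surjective _).1 (inferInstanceAs (Epi (P.π.f 0)))

theorem augmentation_eq_zero_iff (x : P.complex.X 0) :
    P.augmentation x = 0 ↔ ∃ y, (P.complex.d 1 0).hom y = x := by
  refine ⟨(ShortComplex.moduleCat_exact_iff _).1 P.exact₀ x, ?_⟩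
  rintro ⟨y, rfl⟩
  exact ConcreteCategory.congr_hom P.complex_d_comp_π_f_zero y

theorem d_succ_eq_zero_iff {M : ModuleCat.{u} R} (P : ProjectiveResolution M) (n : ℕ)
    (x : P.complex.X (n + 1)) :
    (P.complex.d (n + 1) n).hom x = 0 ↔ ∃ y, (P.complex.d (n + 2) (n + 1)).hom y = x := by
  refine ⟨(ShortComplex.moduleCat_exact_iff _).1 (P.exact_succ n) x, ?_⟩
  rintro ⟨y, rfl⟩
  exact ConcreteCategory.congr_hom (P.complex.d_comp_d (n + 2) (n + 1) n) y

instance {M : ModuleCat.{u} R} (P : ProjectiveResolution M) (n : ℕ) :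
    Module.Projective R (P.complex.X n) :=
  (IsProjective.iff_projective _).2 (P.projective n)

end CategoryTheory.ProjectiveResolution

/-- The element `c` of the colon ideal `(a, b) : J` represents the class `h` in `Ext²(R/J, R)`. -/
def RepresentsExt (a b : R) (J : Ideal R) (c : R)
    (h : ((Ext R (ModuleCat.{u} R) 2).obj (op (ModuleCat.of R (R ⧸ J)))).obj
      (ModuleCat.of R R)) : Prop :=
  ∃ z : (projectiveResolution (ModuleCat.of R (R ⧸ J))).complex.X 2 ⟶ ModuleCat.of R R,
    RepresentsColon a b (projectiveResolution (ModuleCat.of R (R ⧸ J))).augmentation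
      ((projectiveResolution (ModuleCat.of R (R ⧸ J))).complex.d 1 0).hom
      ((projectiveResolution (ModuleCat.of R (R ⧸ J))).complex.d 2 1).hom c z.hom ∧
    IsExtClass _ z h

end Resolution

namespace RepresentsExt

variable {a b : R} {J : Ideal R} {c c' : R}
  {h h' : ((Ext R (ModuleCat.{u} R) 2).obj (op (ModuleCat.of R (R ⧸ J)))).obj (ModuleCat.of R R)}

theorem add (H : RepresentsExt a b J c h) (H' : RepresentsExt a b J c' h') :
    RepresentsExt a b J (c + c') (h + h') := by
  obtain ⟨z, hz, hh⟩ := H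
  obtain ⟨z', hz', hh'⟩ := H'
  exact ⟨z + z', hz.add hz', hh.add hh'⟩

theorem smul (r : R) (H : RepresentsExt a b J c h) : RepresentsExt a b J (r * c) (r • h) := by
  obtain ⟨z, hz, hh⟩ := H
  exact ⟨r • z, hz.smul r, hh.smul r⟩

theorem exists_class (ha : IsRegularMod ⊥ a) (hb : IsRegularMod (Ideal.span {a}) b)
    (hc : ∀ x ∈ J, c * x ∈ Ideal.span {a, b}) : ∃ h, RepresentsExt a b J c h := by
  let P := projectiveResolution (ModuleCat.of R (R ⧸ J))
  obtain ⟨z, hz, hz'⟩ := exists_representsColon P.augmentation_eq_zero_iff (P.d_succ_eq_zero_iff 0)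
    (P.d_succ_eq_zero_iff 1) ha hb hc
  obtain ⟨h, hh⟩ := IsExtClass.exists_of_cocycle P (Y := ModuleCat.of R R) (ModuleCat.ofHom z)
    (ModuleCat.hom_ext (LinearMap.ext hz'))
  exact ⟨h, _, hz, hh⟩

theorem exists_colon (ha : IsRegularMod ⊥ a) (hb : IsRegularMod (Ideal.span {a}) b)
    (haJ : a ∈ J) (hbJ : b ∈ J)
    (h : ((Ext R (ModuleCat.{u} R) 2).obj (op (ModuleCat.of R (R ⧸ J)))).obj
      (ModuleCat.of R R)) :
    ∃ c, (∀ x ∈ J, c * x ∈ Ideal.span {a, b}) ∧ RepresentsExt a b J c h := by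
  let P := projectiveResolution (ModuleCat.of R (R ⧸ J))
  obtain ⟨z, hz⟩ := IsExtClass.exists_cocycle P h
  obtain ⟨c, hc, hc'⟩ := exists_representsColon_of_cocycle P.augmentation_surjective
    P.augmentation_eq_zero_iff (P.d_succ_eq_zero_iff 0) (P.d_succ_eq_zero_iff 1) ha hb haJ hbJ
    z.hom fun y => ConcreteCategory.congr_hom hz.cocycle y
  exact ⟨c, hc, z, hc', hz⟩

theorem eq_zero_iff (ha : IsRegularMod ⊥ a) (hb : IsRegularMod (Ideal.span {a}) b)
    (haJ : a ∈ J) (hbJ : b ∈ J) (H : RepresentsExt a b J c h) :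
    h = 0 ↔ c ∈ Ideal.span {a, b} := by
  let P := projectiveResolution (ModuleCat.of R (R ⧸ J))
  obtain ⟨z, hz, hh⟩ := H
  rw [hh.eq_zero_iff]
  constructor
  · rintro ⟨g, rfl⟩
    exact hz.mem_of_coboundary P.augmentation_surjective P.augmentation_eq_zero_iff
      (P.d_succ_eq_zero_iff 0) ha hb haJ hbJ g.hom fun y => rfl
  · intro hc
    obtain ⟨g, hg⟩ := hz.exists_coboundary
      (fun y => (P.d_succ_eq_zero_iff 0 _).2 ⟨y, rfl⟩) ha hb hc
    exact ⟨ModuleCat.ofHom g, ModuleCat.hom_ext (LinearMap.ext hg)⟩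

theorem map (α β : R) {J' : Ideal R} (hJ : J' ≤ J) (H : RepresentsExt a b J c h) :
    RepresentsExt (a * α) (b * β) J' (α * β * c)
      ((((Ext R (ModuleCat.{u} R) 2).map
        (ModuleCat.ofHom (Submodule.mapQ J' J LinearMap.id hJ)).op).app (ModuleCat.of R R)) h) := by
  obtain ⟨z, hz, hh⟩ := H
  set f := ModuleCat.ofHom (Submodule.mapQ J' J LinearMap.id hJ)
  set P := projectiveResolution (ModuleCat.of R (R ⧸ J))
  set Q := projectiveResolution (ModuleCat.of R (R ⧸ J'))
  have comm := ProjectiveResolution.lift_commutes_zero f Q P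
  refine ⟨_, (hz.comp ((ProjectiveResolution.lift f Q P).f 0).hom
    ((ProjectiveResolution.lift f Q P).f 1).hom ((ProjectiveResolution.lift f Q P).f 2).hom
    (fun x r hx => ?_) (fun y => ?_) fun y => ?_).mul_mul α β, hh.map f _ comm⟩
  · exact (ConcreteCategory.congr_hom comm x).trans (congrArg f.hom hx)
  · exact ConcreteCategory.congr_hom ((ProjectiveResolution.lift f Q P).comm 1 0) y
  · exact ConcreteCategory.congr_hom ((ProjectiveResolution.lift f Q P).comm 2 1) y

end RepresentsExt

end ExtColon

section LocalCohomologyColimit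

open CategoryTheory CategoryTheory.Limits Opposite

universe u

/-- A relation which is linear, total, surjective and detects zero is the graph of a linear
equivalence. -/
theorem LinearEquiv.exists_of_rel {R A B : Type*} [CommRing R] [AddCommGroup A] [Module R A]
    [AddCommGroup B] [Module R B] (r : A → B → Prop)
    (add : ∀ {a a' b b'}, r a b → r a' b' → r (a + a') (b + b'))
    (smul : ∀ (s : R) {a b}, r a b → r (s • a) (s • b)) (total : ∀ a, ∃ b, r a b)
    (surj : ∀ b, ∃ a, r a b) (zero : ∀ {a b}, r a b → (b = 0 ↔ a = 0)) :
    ∃ Θ : A ≃ₗ[R] B, ∀ a b, r a b ↔ Θ a = b := by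
  choose F hF using total
  have uniq : ∀ {a b b'}, r a b → r a b' → b = b' := fun {a b b'} h h' => by
    have := add h (smul (-1) h')
    rw [neg_one_smul, neg_one_smul, add_neg_cancel, ← sub_eq_add_neg] at this
    exact sub_eq_zero.1 ((zero this).2 rfl)
  let L : A →ₗ[R] B :=
    { toFun := F
      map_add' := fun x y => uniq (hF _) (add (hF x) (hF y))
      map_smul' := fun s x => uniq (hF _) (smul s (hF x)) }
  have hL : Function.Bijective L := by
    refine ⟨(injective_iff_map_eq_zero L).2 fun x hx => (zero (hF x)).1 hx, fun b => ?_⟩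
    obtain ⟨a, ha⟩ := surj b
    exact ⟨a, uniq (hF a) ha⟩
  refine ⟨LinearEquiv.ofBijective L hL, fun a b => ⟨uniq (hF a), ?_⟩⟩
  rintro rfl
  exact hF a

theorem Module.DirectLimit.lift_bijective {R : Type*} [CommRing R] {N : ℕ → Type*}
    [∀ i, AddCommGroup (N i)] [∀ i, Module R (N i)] {f : ∀ i j : ℕ, i ≤ j → N i →ₗ[R] N j}
    {L : Type*} [AddCommGroup L] [Module R L] (g : ∀ i, N i →ₗ[R] L)
    (hg : ∀ i j h x, g j (f i j h x) = g i x) (surj : ∀ y, ∃ i x, g i x = y)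
    (inj : ∀ i x, g i x = 0 → ∃ j h, f i j h x = 0) :
    Function.Bijective (Module.DirectLimit.lift R ℕ N f g hg) := by
  refine ⟨(injective_iff_map_eq_zero _).2 fun z hz => ?_, fun y => ?_⟩
  · obtain ⟨i, x, rfl⟩ := Module.DirectLimit.exists_of z
    rw [Module.DirectLimit.lift_of] at hz
    obtain ⟨j, h, hx⟩ := inj i x hz
    rw [← Module.DirectLimit.of_f (hij := h), hx, map_zero]
  · obtain ⟨i, x, rfl⟩ := surj y
    exact ⟨Module.DirectLimit.of R ℕ N f i x, Module.DirectLimit.lift_of _ _ _⟩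

variable {R : Type u} [CommRing R]

/-- The module `Extⁿ(R/J, Y)`. -/
noncomputable abbrev extQuot (n : ℕ) (J : Ideal R) (Y : ModuleCat.{u} R) : ModuleCat.{u} R :=
  ((Ext R (ModuleCat.{u} R) n).obj (op (ModuleCat.of R (R ⧸ J)))).obj Y

/-- The restriction map `Extⁿ(R/J, Y) → Extⁿ(R/J', Y)` for ideals `J' ≤ J`. -/
noncomputable def extRestrict (n : ℕ) (Y : ModuleCat.{u} R) {J' J : Ideal R} (h : J' ≤ J) :
    extQuot n J Y →ₗ[R]
      extQuot n J' Y :=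
  (((Ext R (ModuleCat.{u} R) n).map
    (ModuleCat.ofHom (Submodule.mapQ J' J LinearMap.id h)).op).app Y).hom

namespace localCohomology

variable {I : Ideal R} {J : ℕ → Ideal R}

/-- A decreasing sequence of ideals whose radicals contain `I`, as a functor. -/
def sequenceToSelfLERadical (hJ : Antitone J) (hI : ∀ e, I ≤ (J e).radical) :
    ℕᵒᵖ ⥤ SelfLERadical I :=
  ObjectProperty.lift _
    { obj := fun e => J (unop e)
      map := fun w => ⟨⟨hJ w.unop.down.down⟩⟩ } fun e => hI (unop e)

theorem sequenceToSelfLERadical_initial [IsNoetherianRing R] (hJ : Antitone J)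
    (hI : ∀ e, I ≤ (J e).radical) (hpow : ∀ t, ∃ e, J e ≤ I ^ t) :
    (sequenceToSelfLERadical hJ hI).Initial where
  out J' := by
    apply +allowSynthFailures zigzag_isConnected
    · obtain ⟨t, ht⟩ := Ideal.exists_pow_le_of_le_radical_of_fg J'.2
        (isNoetherian_def.mp inferInstance _)
      obtain ⟨e, he⟩ := hpow t
      exact ⟨CostructuredArrow.mk
        (⟨⟨⟨he.trans ht⟩⟩⟩ : (sequenceToSelfLERadical hJ hI).obj (op e) ⟶ J')⟩
    · intro j₁ j₂
      apply Relation.ReflTransGen.single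
      rcases le_total (unop j₁.left) (unop j₂.left) with h | h
      · right; exact ⟨CostructuredArrow.homMk (homOfLE h).op rfl⟩
      · left; exact ⟨CostructuredArrow.homMk (homOfLE h).op rfl⟩

/-- Local cohomology is the colimit of `Ext` over any decreasing sequence of ideals cofinal with
the powers. -/
theorem exists_cocone [IsNoetherianRing R] (hJ : Antitone J) (hI : ∀ e, I ≤ (J e).radical)
    (hpow : ∀ t, ∃ e, J e ≤ I ^ t) (n : ℕ) (Y : ModuleCat.{u} R) :
    ∃ ι : ∀ e, extQuot n (J e) Y →ₗ[R]
        (localCohomology I n).obj Y,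
      (∀ i j (h : i ≤ j) x, ι j (extRestrict n Y (hJ h) x) = ι i x) ∧
      (∀ y, ∃ i x, ι i x = y) ∧
      ∀ i x, ι i x = 0 → ∃ j, ∃ h : i ≤ j, extRestrict n Y (hJ h) x = 0 := by
  have := sequenceToSelfLERadical_initial hJ hI hpow
  have := preservesSmallestFilteredColimits_of_preservesFilteredColimits
    (forget (ModuleCat.{u} R))
  let K := sequenceToSelfLERadical hJ hI
  let D := diagram (K ⋙ selfLERadicalDiagram I) n
  have : HasColimit D := hasColimitDiagram _ _
  let iso : colimit D ≅ localCohomology I n :=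
    isoOfFinal.{u, u, 0} K (selfLERadicalDiagram I) n ≪≫ isoSelfLERadical I n
  let F := (evaluation (ModuleCat.{u} R) (ModuleCat.{u} R)).obj Y
  have hc : IsColimit (F.mapCocone (colimit.cocone D)) :=
    isColimitOfPreserves F (colimit.isColimit D)
  let iY := (iso.app Y).toLinearEquiv
  let κ := fun e : ℕ => ((colimit.ι D (op (op e))).app Y).hom
  refine ⟨fun e => iY.toLinearMap ∘ₗ κ e, fun i j h x => congrArg iY ?_, fun y => ?_,
    fun i x hx => ?_⟩
  · exact ConcreteCategory.congr_hom
      ((F.mapCocone (colimit.cocone D)).w (homOfLE h).op.op) x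
  · obtain ⟨e, x, hx⟩ := Concrete.isColimit_exists_rep _ hc (iY.symm y)
    exact ⟨unop (unop e), x, (congrArg iY hx).trans (iY.apply_symm_apply y)⟩
  · have hx : κ i x = κ i 0 := by
      rw [map_zero]; exact (LinearEquiv.map_eq_zero_iff iY).1 hx
    obtain ⟨e, f, g, hfg⟩ := Concrete.isColimit_exists_of_rep_eq _ hc (i := op (op i))
      (j := op (op i)) x 0 hx
    refine ⟨unop (unop e), f.unop.unop.le, ?_⟩
    have h0 : (D ⋙ F).map g 0 = 0 := map_zero ((D ⋙ F).map g).hom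
    exact hfg.trans h0

theorem nonempty_linearEquiv_directLimit [IsNoetherianRing R] (hJ : Antitone J)
    (hI : ∀ e, I ≤ (J e).radical) (hpow : ∀ t, ∃ e, J e ≤ I ^ t) (n : ℕ) (Y : ModuleCat.{u} R)
    {N : ℕ → Type u} [∀ i, AddCommGroup (N i)] [∀ i, Module R (N i)]
    (f : ∀ i j : ℕ, i ≤ j → N i →ₗ[R] N j)
    (Θ : ∀ e, N e ≃ₗ[R] extQuot n (J e) Y)
    (hΘ : ∀ i j (h : i ≤ j) x, Θ j (f i j h x) = extRestrict n Y (hJ h) (Θ i x)) :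
    Nonempty ((localCohomology I n).obj Y ≃ₗ[R] Module.DirectLimit N f) := by
  obtain ⟨ι, hι, surj, inj⟩ := exists_cocone hJ hI hpow n Y
  refine ⟨(LinearEquiv.ofBijective _ (Module.DirectLimit.lift_bijective
    (fun i => ι i ∘ₗ (Θ i).toLinearMap) (fun i j h x => ?_) (fun y => ?_)
    fun i x hx => ?_)).symm⟩
  · exact (congrArg (ι j) (hΘ i j h x)).trans (hι i j h _)
  · obtain ⟨i, x, rfl⟩ := surj y
    exact ⟨i, (Θ i).symm x, congrArg (ι i) ((Θ i).apply_symm_apply x)⟩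
  · obtain ⟨j, h, hx⟩ := inj i (Θ i x) hx
    exact ⟨j, h, (LinearEquiv.map_eq_zero_iff (Θ j)).1 ((hΘ i j h x).trans hx)⟩

end localCohomology

end LocalCohomologyColimit

section Frobenius

theorem pow_mem_frobPow {R : Type} [CommRing R] {a : Ideal R} {x : R} (q : ℕ) (hx : x ∈ a) :
    x ^ q ∈ frobPow q a :=
  Ideal.subset_span ⟨x, hx, rfl⟩

theorem frobPow_le_of_le {R : Type} [CommRing R] (a : Ideal R) {q q' : ℕ} (h : q ≤ q') :
    frobPow q' a ≤ frobPow q a := by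
  refine Ideal.span_le.2 ?_
  rintro _ ⟨x, hx, rfl⟩
  exact Ideal.mem_of_dvd _ (pow_dvd_pow x h) (pow_mem_frobPow q hx)

theorem frobPow_le_pow {R : Type} [CommRing R] (a : Ideal R) (q : ℕ) : frobPow q a ≤ a ^ q := by
  refine Ideal.span_le.2 ?_
  rintro _ ⟨x, hx, rfl⟩
  exact Ideal.pow_mem_pow hx q

theorem frobPow_eq_map {R : Type} [CommRing R] (p : ℕ) [ExpChar R p] (e : ℕ) (a : Ideal R) :
    frobPow (p ^ e) a = a.map (iterateFrobenius R p e) := rfl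

variable {k : Type} [Field k] {m : ℕ} {p : ℕ} [CharP k p]

variable (k m) in
theorem maxMinor_powMatrix_one (i : Fin (m + 2)) :
    maxMinor (powMatrix k m 1) i = Gmin k m i := by
  unfold powMatrix
  simp only [pow_one]
  rfl

variable (k m) in
theorem subMinor_powMatrix_one (j : Fin (m + 1)) :
    subMinor (powMatrix k m 1) j = gmin k m j := by
  unfold powMatrix
  simp only [pow_one]
  rfl

instance MvPowerSeries.charP {σ : Type*} : CharP (MvPowerSeries σ k) p :=
  charP_of_injective_algebraMap (algebraMap k (MvPowerSeries σ k)).injective p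

variable [Fact p.Prime]

theorem powMatrix_pow (e : ℕ) :
    powMatrix k m (p ^ e) = (powMatrix k m 1).map (iterateFrobenius _ p e) := by
  ext1 i j
  simp only [powMatrix, Matrix.map_apply, pow_one, iterateFrobenius_def]

theorem maxMinor_powMatrix_pow (e : ℕ) (i : Fin (m + 2)) :
    maxMinor (powMatrix k m (p ^ e)) i = Gmin k m i ^ p ^ e := by
  rw [powMatrix_pow, maxMinor_map, maxMinor_powMatrix_one, iterateFrobenius_def]

theorem subMinor_powMatrix_pow (e : ℕ) (j : Fin (m + 1)) :
    subMinor (powMatrix k m (p ^ e)) j = gmin k m j ^ p ^ e := by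
  rw [powMatrix_pow, subMinor_map, subMinor_powMatrix_one, iterateFrobenius_def]

theorem frobPow_Imax (e : ℕ) : frobPow (p ^ e) (Imax k m) = maxIdeal (powMatrix k m (p ^ e)) := by
  rw [frobPow_eq_map, Imax, Ideal.map_span, ← Set.range_comp, maxIdeal]
  congr 2
  ext1 i
  rw [maxMinor_powMatrix_pow, Function.comp_apply, iterateFrobenius_def]

theorem frobPow_Psub (e : ℕ) : frobPow (p ^ e) (Psub k m) = subIdeal (powMatrix k m (p ^ e)) := by
  rw [frobPow_eq_map, Psub, Ideal.map_span, ← Set.range_comp, subIdeal]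
  congr 2
  ext1 i
  rw [subMinor_powMatrix_pow, Function.comp_apply, iterateFrobenius_def]

theorem frobPow_Omeg (e : ℕ) :
    frobPow (p ^ e) (Omeg k m) =
      maxIdeal (powMatrix k m (p ^ e)) ⊔ subIdeal (powMatrix k m (p ^ e)) := by
  rw [← frobPow_Imax, ← frobPow_Psub, frobPow_eq_map, frobPow_eq_map, frobPow_eq_map, Omeg,
    Ideal.map_sup]

omit [CharP k p] in
theorem minorsRegular_powMatrix_pow (e : ℕ) : MinorsRegular (powMatrix k m (p ^ e)) :=
  minorsRegular_powMatrix (pow_ne_zero _ (Fact.out : p.Prime).ne_zero)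

theorem pow_le_pow_of_fact {i j : ℕ} (h : i ≤ j) : p ^ i ≤ p ^ j :=
  Nat.pow_le_pow_right (Fact.out : p.Prime).pos h

variable (k m p) in
/-- The multiplier of the transition map from level `i` to level `j`. -/
noncomputable def transMul (i j : ℕ) : MvPowerSeries (Fin (m + 2) × Fin (m + 1)) k :=
  (Gmin k m (Fin.last (m + 1)) * Gmin k m (Fin.castSucc (Fin.last m))) ^ (p ^ j - p ^ i)

omit [CharP k p] [Fact p.Prime] in
theorem transMul_self (i : ℕ) : transMul k m p i i = 1 := by
  rw [transMul, Nat.sub_self, pow_zero]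

omit [CharP k p] in
theorem transMul_mul {i j l : ℕ} (hij : i ≤ j) (hjl : j ≤ l) :
    transMul k m p j l * transMul k m p i j = transMul k m p i l := by
  rw [transMul, transMul, transMul, ← pow_add, Nat.sub_add_sub_cancel
    (pow_le_pow_of_fact hjl) (pow_le_pow_of_fact hij)]

omit [CharP k p] [Fact p.Prime] in
theorem ugen_pow (e : ℕ) : ugen k m p ^ p ^ e = transMul k m p e (e + 1) := by
  rw [ugen, transMul, ← pow_mul, Nat.sub_mul, one_mul, pow_succ, mul_comm p]

omit [CharP k p] in
theorem Gmin_pow_mul {i j : ℕ} (h : i ≤ j) (l : Fin (m + 2)) :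
    Gmin k m l ^ p ^ i * Gmin k m l ^ (p ^ j - p ^ i) = Gmin k m l ^ p ^ j := by
  rw [← pow_add, Nat.add_sub_cancel' (pow_le_pow_of_fact h)]

theorem transMul_mul_mem_linkIdeal {i j : ℕ} (h : i ≤ j)
    {x : MvPowerSeries (Fin (m + 2) × Fin (m + 1)) k}
    (hx : x ∈ linkIdeal (powMatrix k m (p ^ i))) :
    transMul k m p i j * x ∈ linkIdeal (powMatrix k m (p ^ j)) := by
  obtain ⟨α, β, rfl⟩ := Ideal.mem_span_pair.1 hx
  refine Ideal.mem_span_pair.2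
    ⟨α * Gmin k m (Fin.castSucc (Fin.last m)) ^ (p ^ j - p ^ i),
      β * Gmin k m (Fin.last (m + 1)) ^ (p ^ j - p ^ i), ?_⟩
  simp only [maxMinor_powMatrix_pow, ← Gmin_pow_mul h, transMul]
  ring

theorem transMul_mul_mem_subIdeal {i j : ℕ} (h : i ≤ j)
    {x : MvPowerSeries (Fin (m + 2) × Fin (m + 1)) k}
    (hx : x ∈ subIdeal (powMatrix k m (p ^ i))) :
    transMul k m p i j * x ∈ subIdeal (powMatrix k m (p ^ j)) := by
  refine (minorsRegular_powMatrix_pow j).mem_subIdeal fun l => ?_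
  have := Ideal.mul_mem_right (Gmin k m l ^ (p ^ j - p ^ i)) _ (transMul_mul_mem_linkIdeal h
    (mul_mem_linkIdeal (powMatrix k m (p ^ i)) (Ideal.subset_span ⟨l, rfl⟩) hx))
  rw [maxMinor_powMatrix_pow] at this ⊢
  rw [← Gmin_pow_mul h]
  convert this using 1
  ring

theorem transMul_mul_mem_maxIdeal {i j : ℕ} (h : i ≤ j)
    {x : MvPowerSeries (Fin (m + 2) × Fin (m + 1)) k}
    (hx : x ∈ maxIdeal (powMatrix k m (p ^ i))) :
    transMul k m p i j * x ∈ maxIdeal (powMatrix k m (p ^ j)) := by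
  refine (minorsRegular_powMatrix_pow j).isRegularMod_maxIdeal _ ?_
  have := Ideal.mul_mem_left _ (gmin k m 0 ^ (p ^ j - p ^ i)) (linkIdeal_le_maxIdeal _
    (transMul_mul_mem_linkIdeal h
      (mul_mem_linkIdeal (powMatrix k m (p ^ i)) hx (Ideal.subset_span ⟨0, rfl⟩))))
  rw [subMinor_powMatrix_pow] at this ⊢
  rw [← Nat.add_sub_cancel' (pow_le_pow_of_fact (p := p) h), pow_add]
  rw [← Nat.add_sub_cancel' (pow_le_pow_of_fact (p := p) h)] at this
  convert this using 1
  simp only [Nat.add_sub_cancel' (pow_le_pow_of_fact (p := p) h)]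
  ring

theorem transMul_mul_mem_Imax {i j : ℕ} (h : i ≤ j)
    {x : MvPowerSeries (Fin (m + 2) × Fin (m + 1)) k} (hx : x ∈ frobPow (p ^ i) (Imax k m)) :
    transMul k m p i j * x ∈ frobPow (p ^ j) (Imax k m) := by
  rw [frobPow_Imax] at hx ⊢
  exact transMul_mul_mem_maxIdeal h hx

theorem transMul_mul_mem_Omeg {i j : ℕ} (h : i ≤ j)
    {x : MvPowerSeries (Fin (m + 2) × Fin (m + 1)) k} (hx : x ∈ frobPow (p ^ i) (Omeg k m)) :
    transMul k m p i j * x ∈ frobPow (p ^ j) (Omeg k m) := by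
  rw [frobPow_Omeg] at hx ⊢
  obtain ⟨y, hy, z, hz, rfl⟩ := Submodule.mem_sup.1 hx
  rw [mul_add]
  exact Submodule.add_mem_sup (transMul_mul_mem_maxIdeal h hy) (transMul_mul_mem_subIdeal h hz)

variable (k m p) in
/-- The transition map of the direct system. -/
noncomputable def quotTrans (i j : ℕ) (h : i ≤ j) :
    quotFrob k m p i →ₗ[MvPowerSeries (Fin (m + 2) × Fin (m + 1)) k] quotFrob k m p j :=
  Submodule.mapQ _ _
    ((LinearMap.mulLeft _ (transMul k m p i j)).restrict fun _ hx => transMul_mul_mem_Omeg h hx)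
    fun _ hx => transMul_mul_mem_Imax h hx

theorem quotTrans_mk {i j : ℕ} (h : i ≤ j) (x : frobPow (p ^ i) (Omeg k m))
    (y : frobPow (p ^ j) (Omeg k m))
    (hy : (y : MvPowerSeries (Fin (m + 2) × Fin (m + 1)) k) = transMul k m p i j * x) :
    quotTrans k m p i j h (Submodule.Quotient.mk x) = Submodule.Quotient.mk y :=
  congrArg _ (Subtype.ext hy.symm)

theorem directedSystem_quotTrans :
    DirectedSystem (quotFrob k m p) (fun i j h => quotTrans k m p i j h) where
  map_self i x := by
    obtain ⟨x, rfl⟩ := Submodule.Quotient.mk_surjective _ x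
    exact quotTrans_mk _ _ _ (by rw [transMul_self, one_mul])
  map_map i j l hij hjl x := by
    obtain ⟨x, rfl⟩ := Submodule.Quotient.mk_surjective _ x
    rw [quotTrans_mk hij x ⟨_, transMul_mul_mem_Omeg hij x.2⟩ rfl,
      quotTrans_mk hjl _ ⟨_, transMul_mul_mem_Omeg hjl (transMul_mul_mem_Omeg hij x.2)⟩ rfl]
    exact (quotTrans_mk _ _ _ (by rw [← transMul_mul hij hjl, mul_assoc])).symm

open CategoryTheory Opposite

/-- The element `n` of `Ω^{[p^e]}/I^{[p^e]}` corresponds to the class `h` in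
`Ext²(R/I^{[p^e]}, R)`. -/
def QuotFrobRepresents (e : ℕ) (n : quotFrob k m p e)
    (h : extQuot 2 (frobPow (p ^ e) (Imax k m))
      (ModuleCat.of _ (MvPowerSeries (Fin (m + 2) × Fin (m + 1)) k))) : Prop :=
  ∃ x : frobPow (p ^ e) (Omeg k m), Submodule.Quotient.mk x = n ∧
    (x : MvPowerSeries (Fin (m + 2) × Fin (m + 1)) k) ∈ subIdeal (powMatrix k m (p ^ e)) ∧
    RepresentsExt (maxMinor (powMatrix k m (p ^ e)) (Fin.last (m + 1)))
      (maxMinor (powMatrix k m (p ^ e)) (Fin.castSucc (Fin.last m)))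
      (frobPow (p ^ e) (Imax k m)) x h

theorem exists_quotFrobEquiv (e : ℕ) :
    ∃ Θ : quotFrob k m p e ≃ₗ[MvPowerSeries (Fin (m + 2) × Fin (m + 1)) k]
      extQuot 2 (frobPow (p ^ e) (Imax k m))
      (ModuleCat.of _ (MvPowerSeries (Fin (m + 2) × Fin (m + 1)) k)),
      ∀ n h, QuotFrobRepresents e n h ↔ Θ n = h := by
  have reg := minorsRegular_powMatrix_pow (k := k) (m := m) (p := p) e
  refine LinearEquiv.exists_of_rel (QuotFrobRepresents e) ?_ ?_ ?_ ?_ ?_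
  · rintro _ _ b b' ⟨x, rfl, hx, hb⟩ ⟨x', rfl, hx', hb'⟩
    exact ⟨x + x', rfl, add_mem hx hx', hb.add hb'⟩
  · rintro s _ b ⟨x, rfl, hx, hb⟩
    exact ⟨s • x, rfl, Ideal.mul_mem_left _ _ hx, hb.smul s⟩
  · intro n
    obtain ⟨⟨x, hx⟩, rfl⟩ := Submodule.Quotient.mk_surjective _ n
    have hx' := hx
    rw [frobPow_Omeg] at hx'
    obtain ⟨y, hy, z, hz, rfl⟩ := Submodule.mem_sup.1 hx'
    have hzΩ : z ∈ frobPow (p ^ e) (Omeg k m) := by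
      rw [frobPow_Omeg]; exact Submodule.mem_sup_right hz
    obtain ⟨h, hh⟩ := RepresentsExt.exists_class (J := frobPow (p ^ e) (Imax k m)) (c := z)
      reg.last reg.castSucc_last fun x hx => by
        rw [frobPow_Imax] at hx
        rw [mul_comm]
        exact mul_mem_linkIdeal _ hx hz
    refine ⟨h, ⟨z, hzΩ⟩, ((Submodule.Quotient.eq _).2 ?_).symm, hz, hh⟩
    rw [Submodule.mem_comap, frobPow_Imax]
    simpa using hy
  · intro h
    obtain ⟨c, hc, hh⟩ := RepresentsExt.exists_colon reg.last reg.castSucc_last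
      (by rw [frobPow_Imax]; exact Ideal.subset_span ⟨_, rfl⟩)
      (by rw [frobPow_Imax]; exact Ideal.subset_span ⟨_, rfl⟩) h
    have hcS : c ∈ subIdeal (powMatrix k m (p ^ e)) := reg.mem_subIdeal fun l =>
      hc _ (by rw [frobPow_Imax]; exact Ideal.subset_span ⟨_, rfl⟩)
    exact ⟨_, ⟨c, by rw [frobPow_Omeg]; exact Submodule.mem_sup_right hcS⟩, rfl, hcS, hh⟩
  · rintro _ b ⟨x, rfl, hx, hb⟩
    rw [hb.eq_zero_iff reg.last reg.castSucc_last
      (by rw [frobPow_Imax]; exact Ideal.subset_span ⟨_, rfl⟩)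
      (by rw [frobPow_Imax]; exact Ideal.subset_span ⟨_, rfl⟩),
      Submodule.Quotient.mk_eq_zero, Submodule.mem_comap, frobPow_Imax]
    exact ⟨fun h => linkIdeal_le_maxIdeal _ h, fun h => reg.mem_linkIdeal hx h⟩

theorem frobPow_pow_antitone {R : Type} [CommRing R] (a : Ideal R) :
    Antitone fun e => frobPow (p ^ e) a :=
  fun _ _ h => frobPow_le_of_le a (pow_le_pow_of_fact h)

theorem QuotFrobRepresents.map {i j : ℕ} (h : i ≤ j) {n : quotFrob k m p i}
    {c : extQuot 2 (frobPow (p ^ i) (Imax k m))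
      (ModuleCat.of _ (MvPowerSeries (Fin (m + 2) × Fin (m + 1)) k))}
    (H : QuotFrobRepresents i n c) :
    QuotFrobRepresents j (quotTrans k m p i j h n)
      (extRestrict 2 _ (frobPow_pow_antitone (p := p) (Imax k m) h) c) := by
  obtain ⟨x, rfl, hx, hc⟩ := H
  refine ⟨⟨_, transMul_mul_mem_Omeg h x.2⟩, (quotTrans_mk h _ _ rfl).symm,
    transMul_mul_mem_subIdeal h hx, ?_⟩
  have := hc.map (Gmin k m (Fin.last (m + 1)) ^ (p ^ j - p ^ i))
    (Gmin k m (Fin.castSucc (Fin.last m)) ^ (p ^ j - p ^ i))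
    (frobPow_pow_antitone (p := p) (Imax k m) h)
  rw [maxMinor_powMatrix_pow, maxMinor_powMatrix_pow, Gmin_pow_mul h, Gmin_pow_mul h,
    ← mul_pow] at this
  rw [maxMinor_powMatrix_pow, maxMinor_powMatrix_pow]
  exact this

theorem nonempty_localCohomology_equiv :
    Nonempty (((localCohomology (Imax k m) 2).obj
      (ModuleCat.of _ (MvPowerSeries (Fin (m + 2) × Fin (m + 1)) k)))
        ≃ₗ[MvPowerSeries (Fin (m + 2) × Fin (m + 1)) k]
      Module.DirectLimit (quotFrob k m p) (fun i j h => quotTrans k m p i j h)) := by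
  choose Θ hΘ using exists_quotFrobEquiv (k := k) (m := m) (p := p)
  refine localCohomology.nonempty_linearEquiv_directLimit
    (frobPow_pow_antitone (p := p) (Imax k m))
    (fun e x hx => ⟨p ^ e, pow_mem_frobPow _ hx⟩)
    (fun t => ⟨t, (frobPow_le_pow _ _).trans
      (Ideal.pow_le_pow_right (Nat.lt_pow_self (Fact.out : p.Prime).one_lt).le)⟩) 2
    _ (quotTrans k m p) Θ fun i j h x => ?_
  exact (hΘ j _ _).1 (((hΘ i _ _).2 rfl).map h)

end Frobenius

/-- With `u = (G_n G_{n-1})^{p-1}`, multiplication by `u^{p^e}` maps `Ω^{[p^e]}` into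
`Ω^{[p^{e+1}]}` and `I^{[p^e]}` into `I^{[p^{e+1}]}`, and `H²_{I_{n-1}(X)}(k[[X]])` is the
colimit of the direct system `Ω/I → Ω^{[p]}/I^{[p]} → ⋯` whose `e`-th transition map is
induced by multiplication by `u^{p^e}`. -/
theorem stmt13 (p : ℕ) (hp : p.Prime) (k : Type) [Field k] [CharP k p] (m : ℕ) :
    (∀ e : ℕ, ∀ x ∈ frobPow (p ^ e) (Omeg k m),
      ugen k m p ^ p ^ e * x ∈ frobPow (p ^ (e + 1)) (Omeg k m)) ∧
    (∀ e : ℕ, ∀ x ∈ frobPow (p ^ e) (Imax k m),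
      ugen k m p ^ p ^ e * x ∈ frobPow (p ^ (e + 1)) (Imax k m)) ∧
    ∃ f : ∀ i j : ℕ, i ≤ j →
        quotFrob k m p i →ₗ[MvPowerSeries (Fin (m + 2) × Fin (m + 1)) k] quotFrob k m p j,
      DirectedSystem (quotFrob k m p) (fun i j h => f i j h) ∧
      (∀ (e : ℕ) (x : ↥(frobPow (p ^ e) (Omeg k m)))
          (y : ↥(frobPow (p ^ (e + 1)) (Omeg k m))),
        (y : MvPowerSeries (Fin (m + 2) × Fin (m + 1)) k) =
          ugen k m p ^ p ^ e * (x : MvPowerSeries (Fin (m + 2) × Fin (m + 1)) k) →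
        f e (e + 1) (Nat.le_succ e) (Submodule.Quotient.mk x) = Submodule.Quotient.mk y) ∧
      Nonempty
        (((localCohomology (Imax k m) 2).obj
            (ModuleCat.of _ (MvPowerSeries (Fin (m + 2) × Fin (m + 1)) k)))
          ≃ₗ[MvPowerSeries (Fin (m + 2) × Fin (m + 1)) k]
          Module.DirectLimit (quotFrob k m p) (fun i j h => f i j h)) := by
  have : Fact p.Prime := ⟨hp⟩
  refine ⟨fun e x hx => ?_, fun e x hx => ?_, quotTrans k m p, directedSystem_quotTrans,
    fun e x y hy => ?_, nonempty_localCohomology_equiv⟩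
  · rw [ugen_pow]
    exact transMul_mul_mem_Omeg (Nat.le_succ e) hx
  · rw [ugen_pow]
    exact transMul_mul_mem_Imax (Nat.le_succ e) hx
  · exact quotTrans_mk _ _ _ (by rw [hy, ugen_pow])
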